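/- arXiv:2409.03461 — 8 statements merged into one kernel-verified Lean document; each statement's English description precedes it below -/
import Mathlib

section
/- Let n, m ≥ 1, let A ∈ ℝ^{m×n}, and let f : ℝ^n → ℝ ∪ {+∞} be convex piecewise linear such that the affine hull of dom(f) = {x | f(x) < +∞} is all of ℝ^n. For b ∈ ℝ^m let S(b) = argmin_{x ∈ ℝ^n} { (1/2)‖Ax − b‖₂² + f(x) }. Then the following are equivalent: (1) there exists a continuous map s : ℝ^m → ℝ^n such that S(b) = {s(b)} for every b ∈ ℝ^m (well-posedness: existence, uniqueness, and continuous dependence on b); (2) S(b) is nonempty for every b ∈ ℝ^m, and for every x ∈ ℝ^n, if row(A) ∩ ∂f(x) ≠ ∅ then dim(∂f(x)) ≥ nullity(A). -/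
noncomputable section

/-- A polyhedral set: a finite intersection of closed halfspaces. -/
def IsPolyhedron {n : ℕ} (P : Set (Fin n → ℝ)) : Prop :=
  ∃ (k : ℕ) (a : Fin k → (Fin n → ℝ)) (β : Fin k → ℝ),
    P = {x | ∀ i, ∑ j, a i j * x j ≤ β i}

/-- Convex piecewise linear function with values in ℝ ∪ {+∞}: the maximum of finitely
many (at least one) affine functions on a polyhedral set `P`, and `+∞` outside `P`. -/
def IsCPWL {n : ℕ} (f : (Fin n → ℝ) → EReal) : Prop :=
  ∃ (k : ℕ) (v : Fin (k + 1) → (Fin n → ℝ)) (w : Fin (k + 1) → ℝ) (P : Set (Fin n → ℝ)),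
    IsPolyhedron P ∧
    (∀ x ∈ P, f x =
      (((Finset.univ.sup' Finset.univ_nonempty fun i => ∑ j, v i j * x j + w i : ℝ)) : EReal)) ∧
    (∀ x ∉ P, f x = ⊤)

/-- The subdifferential of `f` at `x`:
`{v | f y ≥ f x + ⟨v, y - x⟩ for all y}`, read in ℝ ∪ {+∞}. -/
def subdiff {n : ℕ} (f : (Fin n → ℝ) → EReal) (x : Fin n → ℝ) : Set (Fin n → ℝ) :=
  {v | ∀ y, f x + ((∑ j, v j * (y j - x j) : ℝ) : EReal) ≤ f y}

/-- Dimension of a set: the dimension of the linear span of differences of its elements. -/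
def setDim {n : ℕ} (S : Set (Fin n → ℝ)) : ℕ :=
  Module.finrank ℝ (Submodule.span ℝ {d : Fin n → ℝ | ∃ s ∈ S, ∃ s' ∈ S, d = s - s'})

/-- Row space of a matrix: the range of `Aᵀ`. -/
def rowSpace {m n : ℕ} (A : Matrix (Fin m) (Fin n) ℝ) : Set (Fin n → ℝ) :=
  {v | ∃ z : Fin m → ℝ, v = Matrix.vecMul z A}

/-- Nullity of a matrix: the dimension of its kernel. -/
def nullity {m n : ℕ} (A : Matrix (Fin m) (Fin n) ℝ) : ℕ :=
  Module.finrank ℝ (LinearMap.ker A.mulVecLin)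

/-- Solution set `S(b) = argmin_x D(Ax, b) + f(x)` of the regularized regression problem. -/
def solSet {m n : ℕ} (D : (Fin m → ℝ) → (Fin m → ℝ) → ℝ) (A : Matrix (Fin m) (Fin n) ℝ)
    (f : (Fin n → ℝ) → EReal) (b : Fin m → ℝ) : Set (Fin n → ℝ) :=
  {x | ∀ y, ((D (A.mulVec x) b : ℝ) : EReal) + f x ≤ ((D (A.mulVec y) b : ℝ) : EReal) + f y}

/-- The least squares data fidelity `(1/2)‖z - b‖₂²`. -/
def lsq {m : ℕ} (z b : Fin m → ℝ) : ℝ := (1 / 2) * ∑ i, (z i - b i) ^ 2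

/-- Smooth data fidelity: `z ↦ D(z, b)` is strictly convex and differentiable for each `b`,
with gradient (in the first argument) `g z b`, and `b ↦ g z b = ∇_z D(z, b)` is a bijection
of `ℝ^m` for each `z`. -/
def IsSmoothDataFidelity {m : ℕ} (D : (Fin m → ℝ) → (Fin m → ℝ) → ℝ)
    (g : (Fin m → ℝ) → (Fin m → ℝ) → (Fin m → ℝ)) : Prop :=
  (∀ b, StrictConvexOn ℝ Set.univ fun z => D z b) ∧
  (∀ b, Differentiable ℝ fun z => D z b) ∧
  (∀ z b v, fderiv ℝ (fun z' => D z' b) z v = ∑ i, g z b i * v i) ∧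
  (∀ z, Function.Bijective fun b => g z b)

section

open Filter Topology Matrix

theorem dotProduct_self_nonneg_real {m : ℕ} (t : Fin m → ℝ) : 0 ≤ t ⬝ᵥ t :=
  Finset.sum_nonneg fun i _ => mul_self_nonneg (t i)

theorem lsq_add {m : ℕ} (z t b : Fin m → ℝ) :
    lsq (z + t) b = lsq z b - (b - z) ⬝ᵥ t + 1 / 2 * (t ⬝ᵥ t) := by
  simp only [lsq, dotProduct, Pi.add_apply, Pi.sub_apply, Finset.mul_sum]
  rw [← Finset.sum_sub_distrib, ← Finset.sum_add_distrib]
  exact Finset.sum_congr rfl fun i _ => by ring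

theorem lsq_add_smul_le {m : ℕ} (z z' b : Fin m → ℝ) {t : ℝ} (h0 : 0 ≤ t) (h1 : t ≤ 1) :
    lsq (z + t • (z' - z)) b ≤ lsq z b + t * (lsq z' b - lsq z b) := by
  have h2 := lsq_add z (z' - z) b
  have h3 : 0 ≤ (z' - z) ⬝ᵥ (z' - z) := dotProduct_self_nonneg_real _
  rw [add_sub_cancel] at h2
  rw [lsq_add, h2, dotProduct_smul, dotProduct_smul, smul_dotProduct]
  simp only [smul_eq_mul]
  nlinarith [mul_nonneg (mul_nonneg h0 (sub_nonneg.2 h1)) h3]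

/-- A subspace orthogonal to a nonzero kernel vector, of dimension at least the nullity, meets the
row space nontrivially. -/
theorem range_inf_ne_bot {m n : ℕ} (A : Matrix (Fin m) (Fin n) ℝ) {d : Fin n → ℝ}
    (hd : A *ᵥ d = 0) (hd0 : d ≠ 0) {L : Submodule ℝ (Fin n → ℝ)}
    (hLd : L ≤ LinearMap.ker ((dotProductBilin ℝ ℝ).flip d)) (hL : nullity A ≤ Module.finrank ℝ L) :
    LinearMap.range A.vecMulLinear ⊓ L ≠ ⊥ := by
  intro hbot
  have hRd : LinearMap.range A.vecMulLinear ≤ LinearMap.ker ((dotProductBilin ℝ ℝ).flip d) := by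
    rintro _ ⟨z, rfl⟩
    change (z ᵥ* A) ⬝ᵥ d = 0
    rw [← dotProduct_mulVec, hd, dotProduct_zero]
  have hlt : Module.finrank ℝ ↥(LinearMap.range A.vecMulLinear ⊔ L) < n := by
    have := Submodule.finrank_lt (s := LinearMap.range A.vecMulLinear ⊔ L) (fun htop => by
      have hmem : d ∈ LinearMap.range A.vecMulLinear ⊔ L := htop ▸ Submodule.mem_top
      exact hd0 (dotProduct_self_eq_zero.1 (sup_le hRd hLd hmem)))
    simpa using this
  have hsum := Submodule.finrank_sup_add_finrank_inf_eq (LinearMap.range A.vecMulLinear) L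
  rw [hbot, finrank_bot, add_zero] at hsum
  have hrank : Module.finrank ℝ (LinearMap.range A.vecMulLinear) = A.rank := by
    rw [← A.rank_transpose, Matrix.rank, mulVecLin_transpose]
  have hnull := LinearMap.finrank_range_add_finrank_ker A.mulVecLin
  rw [Module.finrank_fin_fun] at hnull
  have : A.rank + nullity A = n := hnull
  omega

/-- **Farkas' lemma** for finitely many linear functionals on a real vector space: a functional
that is nonpositive wherever all the `c i` are is a nonnegative combination of the `c i`. -/
theorem farkas_finset {ι E : Type*} [AddCommGroup E] [Module ℝ E] (s : Finset ι) :
    ∀ (c : ι → E →ₗ[ℝ] ℝ) (g : E →ₗ[ℝ] ℝ),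
      (∀ x, (∀ i ∈ s, c i x ≤ 0) → g x ≤ 0) →
      ∃ l : ι → ℝ, (∀ i, 0 ≤ l i) ∧ g = ∑ i ∈ s, l i • c i := by
  classical
  induction s using Finset.induction_on with
  | empty =>
    intro c g h
    refine ⟨0, fun _ => le_rfl, ?_⟩
    ext x
    have h1 := h x (by simp)
    have h2 := h (-x) (by simp)
    rw [map_neg] at h2
    simp only [Finset.sum_empty, LinearMap.zero_apply]
    linarith
  | insert k s hk ih =>
    intro c g h
    by_cases hs : ∀ x, (∀ i ∈ s, c i x ≤ 0) → g x ≤ 0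
    · obtain ⟨l, hl, hg⟩ := ih c g hs
      refine ⟨Function.update l k 0, fun i => ?_, ?_⟩
      · by_cases hi : i = k
        · simp [hi]
        · simpa [hi] using hl i
      · rw [Finset.sum_insert hk, hg]
        simp only [Function.update_self, zero_smul, zero_add]
        refine Finset.sum_congr rfl fun i hi => ?_
        rw [Function.update_of_ne (by rintro rfl; exact hk hi)]
    · push Not at hs
      obtain ⟨x₀, hx₀, hgx₀⟩ := hs
      have hck : 0 < c k x₀ := by
        by_contra hcon
        refine absurd (h x₀ fun i hi => ?_) (not_le.2 hgx₀)
        rcases Finset.mem_insert.1 hi with rfl | hi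
        · exact not_lt.1 hcon
        · exact hx₀ i hi
      have key : ∀ x, c k (x - (c k x / c k x₀) • x₀) = 0 := fun x => by
        simp [hck.ne']
      obtain ⟨l, hl, hg⟩ := ih (fun i => c i - (c i x₀ / c k x₀) • c k)
        (g - (g x₀ / c k x₀) • c k) (fun x hx => by
          have := h (x - (c k x / c k x₀) • x₀) (fun i hi => by
            rcases Finset.mem_insert.1 hi with rfl | hi
            · exact (key x).le
            · have := hx i hi
              simp only [LinearMap.sub_apply, LinearMap.smul_apply, smul_eq_mul, map_sub,
                map_smul] at this ⊢
              convert this using 2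
              ring)
          simp only [LinearMap.sub_apply, LinearMap.smul_apply, smul_eq_mul, map_sub,
            map_smul] at this ⊢
          convert this using 2
          ring)
      have hsum : ∑ i ∈ s, l i * c i x₀ ≤ 0 :=
        Finset.sum_nonpos fun i hi => mul_nonpos_of_nonneg_of_nonpos (hl i) (hx₀ i hi)
      refine ⟨Function.update l k ((g x₀ - ∑ i ∈ s, l i * c i x₀) / c k x₀), fun i => ?_, ?_⟩
      · by_cases hi : i = k
        · subst hi
          rw [Function.update_self]
          exact div_nonneg (by linarith) hck.le
        · simpa [hi] using hl i
      · rw [Finset.sum_insert hk, Function.update_self]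
        have hcongr : ∑ i ∈ s, Function.update l k
            ((g x₀ - ∑ i ∈ s, l i * c i x₀) / c k x₀) i • c i = ∑ i ∈ s, l i • c i :=
          Finset.sum_congr rfl fun i hi => by
            rw [Function.update_of_ne (by rintro rfl; exact hk hi)]
        rw [hcongr]
        ext x
        have hx := LinearMap.congr_fun hg x
        simp only [LinearMap.sub_apply, LinearMap.smul_apply, smul_eq_mul, LinearMap.sum_apply,
          LinearMap.add_apply, mul_sub, Finset.sum_sub_distrib] at hx ⊢
        have hfac : ∑ i ∈ s, l i * (c i x₀ / c k x₀ * c k x) =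
            (∑ i ∈ s, l i * c i x₀) / c k x₀ * c k x := by
          rw [Finset.sum_div, Finset.sum_mul]
          exact Finset.sum_congr rfl fun i _ => by ring
        rw [hfac] at hx
        rw [sub_div, sub_mul]
        linarith

/-- Farkas' lemma for the dot product. -/
theorem farkas_dotProduct {ι : Type*} [Fintype ι] {n : ℕ} (c : ι → Fin n → ℝ) (g : Fin n → ℝ)
    (h : ∀ x, (∀ i, c i ⬝ᵥ x ≤ 0) → g ⬝ᵥ x ≤ 0) :
    ∃ l : ι → ℝ, (∀ i, 0 ≤ l i) ∧ g = ∑ i, l i • c i := by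
  obtain ⟨l, hl, hg⟩ := farkas_finset Finset.univ
    (fun i => dotProductBilin ℝ ℝ (c i)) (dotProductBilin ℝ ℝ g)
    (fun x hx => h x fun i => hx i (Finset.mem_univ i))
  refine ⟨l, hl, ?_⟩
  refine dotProduct_eq _ _ fun x => ?_
  have := LinearMap.congr_fun hg x
  simpa [sum_dotProduct] using this

/-- `f` equals on the polyhedron `P = {x | a j ⬝ᵥ x ≤ β j}` the maximum `F` of the affine functions
`v i ⬝ᵥ x + w i`, and is `⊤` outside `P`. -/
structure MaxAffineRep {n : ℕ} {ι κ : Type} (f : (Fin n → ℝ) → EReal) (v : ι → Fin n → ℝ)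
    (w : ι → ℝ) (a : κ → Fin n → ℝ) (β : κ → ℝ) (F : (Fin n → ℝ) → ℝ)
    (P : Set (Fin n → ℝ)) : Prop where
  mem_iff : ∀ x, x ∈ P ↔ ∀ j, a j ⬝ᵥ x ≤ β j
  le_val : ∀ i x, v i ⬝ᵥ x + w i ≤ F x
  val_le : ∀ x c, (∀ i, v i ⬝ᵥ x + w i ≤ c) → F x ≤ c
  continuous_val : Continuous F
  eq_coe : ∀ x ∈ P, f x = (F x : EReal)
  eq_top : ∀ x ∉ P, f x = ⊤
  affineSpan_eq : affineSpan ℝ P = ⊤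

theorem IsCPWL.exists_maxAffineRep {n : ℕ} {f : (Fin n → ℝ) → EReal} (hf : IsCPWL f)
    (hdom : affineSpan ℝ {x : Fin n → ℝ | f x < ⊤} = ⊤) :
    ∃ (k l : ℕ) (v : Fin k → Fin n → ℝ) (w : Fin k → ℝ) (a : Fin l → Fin n → ℝ)
      (β : Fin l → ℝ) (F : (Fin n → ℝ) → ℝ) (P : Set (Fin n → ℝ)),
      MaxAffineRep f v w a β F P := by
  obtain ⟨k, v, w, P, ⟨l, a, β, hP⟩, hfP, hfN⟩ := hf
  refine ⟨k + 1, l, v, w, a, β, fun x => Finset.univ.sup' Finset.univ_nonempty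
    fun i => ∑ j, v i j * x j + w i, P, fun x => hP ▸ Iff.rfl, fun i x => ?_, fun x c h => ?_, ?_,
    hfP, hfN, ?_⟩
  · exact Finset.le_sup' (fun i => ∑ j, v i j * x j + w i) (Finset.mem_univ i)
  · exact Finset.sup'_le _ _ fun i _ => h i
  · refine Continuous.finset_sup'_apply _ fun i _ => ?_
    fun_prop
  · rw [← hdom]
    congr 1
    ext x
    rw [Set.mem_ofPred_eq]
    by_cases hx : x ∈ P
    · simp only [hx, hfP x hx, EReal.coe_lt_top]
    · simp only [hx, hfN x hx, lt_self_iff_false]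

namespace MaxAffineRep

variable {n m : ℕ} {ι κ : Type} {f : (Fin n → ℝ) → EReal} {v : ι → Fin n → ℝ}
  {w : ι → ℝ} {a : κ → Fin n → ℝ} {β : κ → ℝ} {F : (Fin n → ℝ) → ℝ} {P : Set (Fin n → ℝ)}

theorem nonempty (h : MaxAffineRep f v w a β F P) : P.Nonempty := by
  rw [Set.nonempty_iff_ne_empty]
  rintro rfl
  simpa using h.affineSpan_eq

theorem mem_of_add_mem (h : MaxAffineRep f v w a β F P) {x : Fin n → ℝ} {y : Fin n → ℝ}
    (hx : x ∈ P) (hy : y ∈ P) {t : ℝ} (h0 : 0 ≤ t) (h1 : t ≤ 1) : x + t • (y - x) ∈ P := by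
  rw [h.mem_iff] at *
  intro j
  rw [dotProduct_add, dotProduct_smul, dotProduct_sub, smul_eq_mul]
  nlinarith [hx j, hy j]

theorem val_add_le (h : MaxAffineRep f v w a β F P) (x y : Fin n → ℝ) {t : ℝ} (h0 : 0 ≤ t)
    (h1 : t ≤ 1) : F (x + t • (y - x)) ≤ F x + t * (F y - F x) := by
  refine h.val_le _ _ fun i => ?_
  rw [dotProduct_add, dotProduct_smul, dotProduct_sub, smul_eq_mul]
  nlinarith [h.le_val i x, h.le_val i y]

theorem isClosed (h : MaxAffineRep f v w a β F P) : IsClosed P := by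
  have : P = ⋂ j, {x | a j ⬝ᵥ x ≤ β j} := by
    ext x
    simp [h.mem_iff]
  rw [this]
  exact isClosed_iInter fun j => isClosed_le (by fun_prop) continuous_const

theorem mem_subdiff_iff (h : MaxAffineRep f v w a β F P) {x u : Fin n → ℝ} :
    u ∈ subdiff f x ↔ x ∈ P ∧ ∀ y ∈ P, F x + u ⬝ᵥ (y - x) ≤ F y := by
  change (∀ y, f x + ((u ⬝ᵥ (y - x) : ℝ) : EReal) ≤ f y) ↔ _
  constructor
  · intro hu
    have hx : x ∈ P := by
      by_contra hx
      obtain ⟨y, hy⟩ := h.nonempty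
      have := hu y
      rw [h.eq_top x hx, h.eq_coe y hy, EReal.top_add_coe] at this
      exact absurd this (not_le.2 (EReal.coe_lt_top _))
    refine ⟨hx, fun y hy => ?_⟩
    have := hu y
    rw [h.eq_coe x hx, h.eq_coe y hy] at this
    exact_mod_cast this
  · rintro ⟨hx, hu⟩ y
    by_cases hy : y ∈ P
    · rw [h.eq_coe x hx, h.eq_coe y hy]
      exact_mod_cast hu y hy
    · rw [h.eq_top y hy]
      exact le_top

theorem mem_solSet_iff (h : MaxAffineRep f v w a β F P)
    {D : (Fin m → ℝ) → (Fin m → ℝ) → ℝ} {A : Matrix (Fin m) (Fin n) ℝ} {b : Fin m → ℝ}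
    {x : Fin n → ℝ} :
    x ∈ solSet D A f b ↔ x ∈ P ∧ ∀ y ∈ P, D (A *ᵥ x) b + F x ≤ D (A *ᵥ y) b + F y := by
  change (∀ y, ((D (A *ᵥ x) b : ℝ) : EReal) + f x ≤ ((D (A *ᵥ y) b : ℝ) : EReal) + f y) ↔ _
  constructor
  · intro hu
    have hx : x ∈ P := by
      by_contra hx
      obtain ⟨y, hy⟩ := h.nonempty
      have := hu y
      rw [h.eq_top x hx, h.eq_coe y hy, EReal.coe_add_top, ← EReal.coe_add] at this
      exact absurd this (not_le.2 (EReal.coe_lt_top _))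
    refine ⟨hx, fun y hy => ?_⟩
    have := hu y
    rw [h.eq_coe x hx, h.eq_coe y hy] at this
    exact_mod_cast this
  · rintro ⟨hx, hu⟩ y
    by_cases hy : y ∈ P
    · rw [h.eq_coe x hx, h.eq_coe y hy]
      exact_mod_cast hu y hy
    · rw [h.eq_top y hy, EReal.coe_add_top]
      exact le_top

/-- A small step along a direction that is feasible for the active constraints stays in `P`, and
increases `F` at most at the rate of the active affine pieces. -/
theorem eventually_step [Finite ι] [Finite κ] (h : MaxAffineRep f v w a β F P) {x p : Fin n → ℝ}
    {σ : ℝ} (hx : x ∈ P) (hv : ∀ i, v i ⬝ᵥ x + w i = F x → v i ⬝ᵥ p ≤ σ)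
    (ha : ∀ j, a j ⬝ᵥ x = β j → a j ⬝ᵥ p ≤ 0) :
    ∀ᶠ ε in 𝓝[>] (0 : ℝ), x + ε • p ∈ P ∧ F (x + ε • p) ≤ F x + ε * σ := by
  have h1 : ∀ᶠ ε in 𝓝[>] (0 : ℝ), ∀ j, a j ⬝ᵥ (x + ε • p) ≤ β j := by
    rw [eventually_all]
    intro j
    rcases ((h.mem_iff x).1 hx j).eq_or_lt with hj | hj
    · filter_upwards [self_mem_nhdsWithin] with ε hε
      rw [dotProduct_add, dotProduct_smul, smul_eq_mul, hj]
      nlinarith [ha j hj, Set.mem_Ioi.1 hε]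
    · have hc : Continuous fun ε : ℝ => a j ⬝ᵥ (x + ε • p) := by fun_prop
      have := hc.continuousAt.eventually_lt (x₀ := (0 : ℝ)) continuousAt_const (by simpa using hj)
      exact (this.filter_mono nhdsWithin_le_nhds).mono fun ε hε => hε.le
  have h2 : ∀ᶠ ε in 𝓝[>] (0 : ℝ), ∀ i, v i ⬝ᵥ (x + ε • p) + w i ≤ F x + ε * σ := by
    rw [eventually_all]
    intro i
    rcases (h.le_val i x).eq_or_lt with hi | hi
    · filter_upwards [self_mem_nhdsWithin] with ε hε
      rw [dotProduct_add, dotProduct_smul, smul_eq_mul, ← hi]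
      nlinarith [hv i hi, Set.mem_Ioi.1 hε]
    · have hc : Continuous fun ε : ℝ => v i ⬝ᵥ (x + ε • p) + w i := by fun_prop
      have hd : Continuous fun ε : ℝ => F x + ε * σ := by fun_prop
      have := hc.continuousAt.eventually_lt (x₀ := (0 : ℝ)) hd.continuousAt (by simpa using hi)
      exact (this.filter_mono nhdsWithin_le_nhds).mono fun ε hε => hε.le
  filter_upwards [h1, h2] with ε e1 e2
  exact ⟨(h.mem_iff _).2 e1, h.val_le _ _ e2⟩

theorem active_mem_subdiff (h : MaxAffineRep f v w a β F P) {x : Fin n → ℝ} (hx : x ∈ P) {i : ι}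
    (hi : v i ⬝ᵥ x + w i = F x) : v i ∈ subdiff f x := by
  refine h.mem_subdiff_iff.2 ⟨hx, fun y _ => ?_⟩
  have := h.le_val i y
  rw [dotProduct_sub]
  linarith

theorem add_active_mem_subdiff (h : MaxAffineRep f v w a β F P) {x u : Fin n → ℝ}
    (hu : u ∈ subdiff f x) {j : κ} (hj : a j ⬝ᵥ x = β j) : u + a j ∈ subdiff f x := by
  obtain ⟨hx, hu⟩ := h.mem_subdiff_iff.1 hu
  refine h.mem_subdiff_iff.2 ⟨hx, fun y hy => ?_⟩
  have h1 := hu y hy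
  have h2 := (h.mem_iff y).1 hy j
  rw [add_dotProduct, dotProduct_sub (a j)]
  linarith

/-- If `g` is nonpositive on all directions in which `F - u` does not increase at `x`, then `u` can
be moved a little along `g` within the subdifferential. -/
theorem exists_add_smul_mem_subdiff [Finite ι] [Finite κ] (h : MaxAffineRep f v w a β F P)
    {x u g : Fin n → ℝ} (hu : u ∈ subdiff f x)
    (hg : ∀ p, (∀ i, v i ⬝ᵥ x + w i = F x → v i ⬝ᵥ p ≤ u ⬝ᵥ p) →
      (∀ j, a j ⬝ᵥ x = β j → a j ⬝ᵥ p ≤ 0) → g ⬝ᵥ p ≤ 0) :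
    ∃ ε₀ > 0, ∀ ε : ℝ, 0 ≤ ε → ε ≤ ε₀ → u + ε • g ∈ subdiff f x := by
  classical
  have := Fintype.ofFinite ι
  have := Fintype.ofFinite κ
  obtain ⟨hx, hux⟩ := h.mem_subdiff_iff.1 hu
  obtain ⟨l, hl, hgl⟩ := farkas_dotProduct
    (Sum.elim (fun i : {i // v i ⬝ᵥ x + w i = F x} => v i - u)
      (fun j : {j // a j ⬝ᵥ x = β j} => a j)) g (fun p hp => by
        refine hg p (fun i hi => ?_) fun j hj => hp (Sum.inr ⟨j, hj⟩)
        have := hp (Sum.inl ⟨i, hi⟩)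
        rw [Sum.elim_inl, sub_dotProduct] at this
        linarith)
  have hL : 0 ≤ ∑ k, l k := Finset.sum_nonneg fun k _ => hl k
  refine ⟨1 / (∑ k, l k + 1), by positivity, fun ε h0 h1 => ?_⟩
  refine h.mem_subdiff_iff.2 ⟨hx, fun y hy => ?_⟩
  have hδ := hux y hy
  have hgs : g ⬝ᵥ (y - x) ≤ (∑ k, l k) * (F y - F x - u ⬝ᵥ (y - x)) := by
    rw [hgl, sum_dotProduct, Finset.sum_mul]
    refine Finset.sum_le_sum fun k _ => ?_
    rw [smul_dotProduct, smul_eq_mul]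
    refine mul_le_mul_of_nonneg_left ?_ (hl k)
    rcases k with ⟨i, hi⟩ | ⟨j, hj⟩
    · rw [Sum.elim_inl, sub_dotProduct, dotProduct_sub (v i)]
      have := h.le_val i y
      linarith
    · rw [Sum.elim_inr, dotProduct_sub (a j)]
      have := (h.mem_iff y).1 hy j
      linarith
  rw [add_dotProduct, smul_dotProduct, smul_eq_mul]
  have hε : ε * (∑ k, l k) ≤ 1 := by
    rw [le_div_iff₀ (by positivity)] at h1
    nlinarith
  have h3 := mul_le_mul_of_nonneg_left hgs h0
  nlinarith

/-- Moving `x` a little along a direction in which `F - u` does not increase replaces the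
subdifferential by a subset of its face exposed by that direction. -/
theorem exists_subdiff_subset [Finite ι] [Finite κ] (h : MaxAffineRep f v w a β F P)
    {x u p : Fin n → ℝ} (hu : u ∈ subdiff f x)
    (hv : ∀ i, v i ⬝ᵥ x + w i = F x → v i ⬝ᵥ p ≤ u ⬝ᵥ p)
    (ha : ∀ j, a j ⬝ᵥ x = β j → a j ⬝ᵥ p ≤ 0) :
    ∃ x', u ∈ subdiff f x' ∧ subdiff f x' ⊆ subdiff f x ∧
      ∀ g ∈ subdiff f x', g ⬝ᵥ p = u ⬝ᵥ p := by
  obtain ⟨hx, hux⟩ := h.mem_subdiff_iff.1 hu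
  obtain ⟨ε, ⟨hεP, hεF⟩, hε⟩ :=
    ((h.eventually_step hx hv ha).and self_mem_nhdsWithin).exists
  have hε : 0 < ε := hε
  have hmid : x + (ε / 2) • p = x + (1 / 2 : ℝ) • (x + ε • p - x) := by
    rw [add_sub_cancel_left, smul_smul]
    congr 2
    ring
  have hP : x + (ε / 2) • p ∈ P := by
    rw [hmid]
    exact h.mem_of_add_mem hx hεP (by norm_num) (by norm_num)
  have hF : F (x + (ε / 2) • p) = F x + ε / 2 * (u ⬝ᵥ p) := by
    apply le_antisymm
    · rw [hmid]
      have := h.val_add_le x (x + ε • p) (t := 1 / 2) (by norm_num) (by norm_num)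
      linarith
    · have := hux _ hP
      rwa [add_sub_cancel_left, dotProduct_smul, smul_eq_mul] at this
  have hsub : ∀ (g y : Fin n → ℝ), g ⬝ᵥ (y - (x + (ε / 2) • p)) =
      g ⬝ᵥ (y - x) - ε / 2 * (g ⬝ᵥ p) := fun g y => by
    rw [← sub_sub, dotProduct_sub _ (y - x), dotProduct_smul, smul_eq_mul]
  have hface : ∀ g ∈ subdiff f (x + (ε / 2) • p), g ⬝ᵥ p = u ⬝ᵥ p := by
    intro g hg
    obtain ⟨_, hg⟩ := h.mem_subdiff_iff.1 hg
    have h1 := hg x hx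
    have h2 := hg _ hεP
    rw [hsub, hF] at h1 h2
    rw [add_sub_cancel_left, dotProduct_smul, smul_eq_mul] at h2
    rw [sub_self, dotProduct_zero] at h1
    apply le_antisymm <;> nlinarith
  refine ⟨x + (ε / 2) • p, ?_, fun g hg => ?_, hface⟩
  · refine h.mem_subdiff_iff.2 ⟨hP, fun y hy => ?_⟩
    rw [hsub, hF]
    linarith [hux y hy]
  · refine h.mem_subdiff_iff.2 ⟨hx, fun y hy => ?_⟩
    have h1 := (h.mem_subdiff_iff.1 hg).2 y hy
    rw [hsub, hF, hface g hg] at h1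
    linarith

/-- The subdifferential contains no line. -/
theorem eq_zero_of_forall_add_smul_mem (h : MaxAffineRep f v w a β F P) {x u g : Fin n → ℝ}
    (hg : ∀ t : ℝ, u + t • g ∈ subdiff f x) : g = 0 := by
  have hx : x ∈ P := (h.mem_subdiff_iff.1 (hg 0)).1
  have hP : ∀ y ∈ P, g ⬝ᵥ (y - x) = 0 := by
    intro y hy
    by_contra hne
    have := (h.mem_subdiff_iff.1 (hg ((F y - F x - u ⬝ᵥ (y - x) + 1) / (g ⬝ᵥ (y - x))))).2 y hy
    rw [add_dotProduct, smul_dotProduct, smul_eq_mul, div_mul_cancel₀ _ hne] at this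
    linarith
  have hle : affineSpan ℝ P ≤ AffineSubspace.mk' x (LinearMap.ker (dotProductBilin ℝ ℝ g)) := by
    refine affineSpan_le.2 fun y hy => ?_
    rw [SetLike.mem_coe, AffineSubspace.mem_mk', vsub_eq_sub, LinearMap.mem_ker]
    exact hP y hy
  rw [h.affineSpan_eq] at hle
  have := hle (AffineSubspace.mem_top ℝ _ (x + g))
  rw [AffineSubspace.mem_mk', vsub_eq_sub, LinearMap.mem_ker, add_sub_cancel_left] at this
  exact dotProduct_self_eq_zero.1 this

/-- The optimality condition for regularized least squares. -/
theorem mem_solSet_lsq_iff (h : MaxAffineRep f v w a β F P) {A : Matrix (Fin m) (Fin n) ℝ}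
    {b : Fin m → ℝ} {x : Fin n → ℝ} :
    x ∈ solSet lsq A f b ↔ (b - A *ᵥ x) ᵥ* A ∈ subdiff f x := by
  have hq : ∀ s : Fin n → ℝ, lsq (A *ᵥ (x + s)) b =
      lsq (A *ᵥ x) b - ((b - A *ᵥ x) ᵥ* A) ⬝ᵥ s + 1 / 2 * ((A *ᵥ s) ⬝ᵥ (A *ᵥ s)) := fun s => by
    rw [← dotProduct_mulVec, mulVec_add, lsq_add]
  rw [h.mem_solSet_iff, h.mem_subdiff_iff]
  refine and_congr_right fun hx => ⟨fun hs y hy => ?_, fun hu y hy => ?_⟩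
  · by_contra! hlt
    have hev : ∀ᶠ t in 𝓝[>] (0 : ℝ), t * (1 / 2 * ((A *ᵥ (y - x)) ⬝ᵥ (A *ᵥ (y - x)))) <
        F x + ((b - A *ᵥ x) ᵥ* A) ⬝ᵥ (y - x) - F y := by
      have hc : Continuous fun t : ℝ => t * (1 / 2 * ((A *ᵥ (y - x)) ⬝ᵥ (A *ᵥ (y - x)))) := by
        fun_prop
      refine (hc.continuousAt.eventually_lt (x₀ := (0 : ℝ)) continuousAt_const
        ?_).filter_mono nhdsWithin_le_nhds
      rw [zero_mul]
      linarith
    obtain ⟨t, ht, ht0, ht1⟩ := (hev.and (Ioc_mem_nhdsGT one_pos)).exists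
    have h1 := hs _ (h.mem_of_add_mem hx hy ht0.le ht1)
    have h2 := h.val_add_le x y ht0.le ht1
    rw [hq, mulVec_smul, dotProduct_smul, dotProduct_smul, smul_dotProduct] at h1
    simp only [smul_eq_mul] at h1
    have h3 := mul_lt_mul_of_pos_left ht ht0
    nlinarith
  · have h1 := hu y hy
    have h2 := hq (y - x)
    rw [add_sub_cancel] at h2
    have h3 : 0 ≤ (A *ᵥ (y - x)) ⬝ᵥ (A *ᵥ (y - x)) := dotProduct_self_nonneg_real _
    rw [h2]
    linarith

/-- Well-posedness forces every subdifferential that meets the row space to have dimension at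
least the nullity. -/
theorem nullity_le_of_subsingleton [Finite ι] [Finite κ] (h : MaxAffineRep f v w a β F P)
    {A : Matrix (Fin m) (Fin n) ℝ} (hS : ∀ b, (solSet lsq A f b).Subsingleton) {x : Fin n → ℝ}
    (hx : (rowSpace A ∩ subdiff f x).Nonempty) : nullity A ≤ setDim (subdiff f x) := by
  by_contra! hlt
  obtain ⟨_, ⟨z, rfl⟩, hz⟩ := hx
  have hxP := (h.mem_subdiff_iff.1 hz).1
  set L := Submodule.span ℝ
    {d : Fin n → ℝ | ∃ s ∈ subdiff f x, ∃ s' ∈ subdiff f x, d = s - s'}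
  obtain ⟨⟨d, hdA⟩, hdL, hd0⟩ := Submodule.exists_mem_ne_zero_of_ne_bot
    (LinearMap.ker_ne_bot_of_finrank_lt
      (f := (((dotProductBilin ℝ ℝ).domRestrict₂ L).domRestrict
        (LinearMap.ker A.mulVecLin) : _ →ₗ[ℝ] L →ₗ[ℝ] ℝ))
      (by
        have : Module.finrank ℝ (L →ₗ[ℝ] ℝ) = Module.finrank ℝ L := Subspace.dual_finrank_eq
        rw [this]
        exact hlt))
  have hdA' : A *ᵥ d = 0 := hdA
  have hd0' : d ≠ 0 := fun hd => hd0 (by simp [hd])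
  have hdiff : ∀ s ∈ subdiff f x, ∀ s' ∈ subdiff f x, s ⬝ᵥ d = s' ⬝ᵥ d := by
    intro s hs s' hs'
    have := LinearMap.congr_fun (LinearMap.mem_ker.1 hdL)
      ⟨s - s', Submodule.subset_span ⟨s, hs, s', hs', rfl⟩⟩
    have : d ⬝ᵥ (s - s') = 0 := this
    rw [dotProduct_comm, sub_dotProduct] at this
    linarith
  have hzd : (z ᵥ* A) ⬝ᵥ d = 0 := by rw [← dotProduct_mulVec, hdA', dotProduct_zero]
  obtain ⟨ε, ⟨hεP, hεF⟩, hε⟩ := ((h.eventually_step (p := d) (σ := 0) hxP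
    (fun i hi => ((hdiff _ (h.active_mem_subdiff hxP hi) _ hz).trans hzd).le)
    (fun j hj => by
      have := hdiff _ (h.add_active_mem_subdiff hz hj) _ hz
      rw [add_dotProduct] at this
      linarith)).and self_mem_nhdsWithin).exists
  have hε : 0 < ε := hε
  have hAε : A *ᵥ (x + ε • d) = A *ᵥ x := by
    rw [mulVec_add, mulVec_smul, hdA', smul_zero, add_zero]
  have h1 : x ∈ solSet lsq A f (z + A *ᵥ x) := by
    rw [h.mem_solSet_lsq_iff, add_sub_cancel_right]
    exact hz
  have h2 : x + ε • d ∈ solSet lsq A f (z + A *ᵥ x) := by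
    rw [h.mem_solSet_iff] at h1 ⊢
    refine ⟨hεP, fun y hy => ?_⟩
    rw [hAε]
    linarith [h1.2 y hy]
  have := hS _ h1 h2
  rw [left_eq_add, smul_eq_zero] at this
  exact hd0' (this.resolve_left (ne_of_gt hε))

/-- Descending through faces of the subdifferential down to one transversal to the row space shows
that no nonzero kernel direction is orthogonal to a subdifferential meeting the row space. -/
theorem eq_zero_of_mulVec_eq_zero [Finite ι] [Finite κ] (h : MaxAffineRep f v w a β F P)
    {A : Matrix (Fin m) (Fin n) ℝ}
    (hA : ∀ x, (rowSpace A ∩ subdiff f x).Nonempty → nullity A ≤ setDim (subdiff f x))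
    {d : Fin n → ℝ} (hd : A *ᵥ d = 0) {x u : Fin n → ℝ} (hu : u ∈ rowSpace A)
    (hux : u ∈ subdiff f x) (hdx : ∀ g ∈ subdiff f x, g ⬝ᵥ d = 0) : d = 0 := by
  induction hN : setDim (subdiff f x) using Nat.strong_induction_on generalizing x u with
  | _ N ih =>
  subst hN
  by_contra hd0
  set L := Submodule.span ℝ
    {d : Fin n → ℝ | ∃ s ∈ subdiff f x, ∃ s' ∈ subdiff f x, d = s - s'}
  obtain ⟨g, ⟨hgR, hgL⟩, hg0⟩ := Submodule.exists_mem_ne_zero_of_ne_bot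
    (range_inf_ne_bot A hd hd0 (L := L) (Submodule.span_le.2 (by
      rintro _ ⟨s, hs, s', hs', rfl⟩
      change (s - s') ⬝ᵥ d = 0
      rw [sub_dotProduct, hdx s hs, hdx s' hs', sub_zero])) (hA x ⟨u, hu, hux⟩))
  obtain ⟨z, hz⟩ := hu
  obtain ⟨z', hz' : z' ᵥ* A = g⟩ := hgR
  have hp : ∀ t : ℝ, u + t • g ∈ subdiff f x → ∀ p,
      (∀ i, v i ⬝ᵥ x + w i = F x → v i ⬝ᵥ p ≤ (u + t • g) ⬝ᵥ p) →
      (∀ j, a j ⬝ᵥ x = β j → a j ⬝ᵥ p ≤ 0) → g ⬝ᵥ p = 0 := by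
    intro t ht p hpv hpa
    by_contra hgp
    obtain ⟨x', hux', hsub, hface⟩ := h.exists_subdiff_subset ht hpv hpa
    refine hd0 (ih _ ?_ (x := x') (u := u + t • g)
      ⟨z + t • z', by rw [hz, ← hz', add_vecMul, smul_vecMul]⟩ hux'
      (fun g hg => hdx g (hsub hg)) rfl)
    refine Submodule.finrank_lt_finrank_of_lt (lt_of_le_of_ne (Submodule.span_mono ?_) ?_)
    · rintro _ ⟨s, hs, s', hs', rfl⟩
      exact ⟨s, hsub hs, s', hsub hs', rfl⟩
    · intro heq
      have hle : Submodule.span ℝ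
          {d : Fin n → ℝ | ∃ s ∈ subdiff f x', ∃ s' ∈ subdiff f x', d = s - s'} ≤
          LinearMap.ker ((dotProductBilin ℝ ℝ).flip p) := Submodule.span_le.2 (by
        rintro _ ⟨s, hs, s', hs', rfl⟩
        change (s - s') ⬝ᵥ p = 0
        rw [sub_dotProduct, hface s hs, hface s' hs', sub_self])
      rw [heq] at hle
      exact hgp (hle hgL)
  have hclosed : IsClosed {t : ℝ | u + t • g ∈ subdiff f x} := by
    have : {t : ℝ | u + t • g ∈ subdiff f x} =
        ⋂ y ∈ P, {t : ℝ | F x + (u + t • g) ⬝ᵥ (y - x) ≤ F y} := by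
      ext t
      simp [h.mem_subdiff_iff, (h.mem_subdiff_iff.1 hux).1]
    rw [this]
    exact isClosed_biInter fun y _ => isClosed_le (by fun_prop) continuous_const
  have hopen : IsOpen {t : ℝ | u + t • g ∈ subdiff f x} := by
    refine Metric.isOpen_iff.2 fun t ht => ?_
    obtain ⟨ε₁, hε₁, h₁⟩ := h.exists_add_smul_mem_subdiff (g := g) ht
      fun p hpv hpa => (hp t ht p hpv hpa).le
    obtain ⟨ε₂, hε₂, h₂⟩ := h.exists_add_smul_mem_subdiff (g := -g) ht
      fun p hpv hpa => by rw [neg_dotProduct, hp t ht p hpv hpa, neg_zero]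
    refine ⟨min ε₁ ε₂, lt_min hε₁ hε₂, fun r hr => ?_⟩
    rw [Metric.mem_ball, Real.dist_eq, lt_min_iff] at hr
    rw [Set.mem_ofPred_eq]
    rcases le_total t r with htr | htr
    · rw [abs_of_nonneg (sub_nonneg.2 htr)] at hr
      have := h₁ (r - t) (sub_nonneg.2 htr) hr.1.le
      rwa [add_assoc, ← add_smul, add_sub_cancel] at this
    · rw [abs_of_nonpos (sub_nonpos.2 htr)] at hr
      have := h₂ (-(r - t)) (by linarith) hr.2.le
      rwa [neg_smul_neg, add_assoc, ← add_smul, add_sub_cancel] at this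
  have huniv := IsClopen.eq_univ ⟨hclosed, hopen⟩ ⟨0, by simpa using hux⟩
  exact hg0 (h.eq_zero_of_forall_add_smul_mem fun t => Set.eq_univ_iff_forall.1 huniv t)

theorem solSet_subsingleton [Finite ι] [Finite κ] (h : MaxAffineRep f v w a β F P)
    {A : Matrix (Fin m) (Fin n) ℝ}
    (hA : ∀ x, (rowSpace A ∩ subdiff f x).Nonempty → nullity A ≤ setDim (subdiff f x))
    (b : Fin m → ℝ) : (solSet lsq A f b).Subsingleton := by
  intro x hx y hy
  rw [h.mem_solSet_lsq_iff] at hx hy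
  obtain ⟨hxP, hx'⟩ := h.mem_subdiff_iff.1 hx
  obtain ⟨hyP, hy'⟩ := h.mem_subdiff_iff.1 hy
  have hxy := hx' y hyP
  have hyx := hy' x hxP
  have hAd : A *ᵥ (y - x) = 0 := by
    refine dotProduct_self_eq_zero.1 (le_antisymm ?_ (dotProduct_self_nonneg_real _))
    rw [← dotProduct_mulVec] at hxy hyx
    have e1 : A *ᵥ (x - y) = -(A *ᵥ (y - x)) := by rw [← mulVec_neg, neg_sub]
    have e2 : A *ᵥ y = A *ᵥ x + A *ᵥ (y - x) := by rw [← mulVec_add, add_sub_cancel]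
    rw [e1, e2, ← sub_sub, dotProduct_neg, sub_dotProduct _ (A *ᵥ (y - x))] at hyx
    linarith
  have hAxy : A *ᵥ y = A *ᵥ x := by rwa [mulVec_sub, sub_eq_zero] at hAd
  have hu0 : ((b - A *ᵥ x) ᵥ* A) ⬝ᵥ (y - x) = 0 := by
    rw [← dotProduct_mulVec, hAd, dotProduct_zero]
  rw [hAxy, ← neg_sub y x, dotProduct_neg] at hyx
  have hmP : x + (1 / 2 : ℝ) • (y - x) ∈ P :=
    h.mem_of_add_mem hxP hyP (by norm_num) (by norm_num)
  have hmF := h.val_add_le x y (t := 1 / 2) (by norm_num) (by norm_num)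
  have hFm : F (x + (1 / 2 : ℝ) • (y - x)) = F x := by
    have := hx' _ hmP
    rw [add_sub_cancel_left, dotProduct_smul, hu0] at this
    apply le_antisymm
    · linarith
    · simpa using this
  have hym : y - (x + (1 / 2 : ℝ) • (y - x)) = (1 / 2 : ℝ) • (y - x) := by
    ext i
    simp only [Pi.sub_apply, Pi.add_apply, Pi.smul_apply, smul_eq_mul]
    ring
  have hxm : x - (x + (1 / 2 : ℝ) • (y - x)) = -((1 / 2 : ℝ) • (y - x)) := by
    rw [sub_add_cancel_left]
  refine (sub_eq_zero.1 (h.eq_zero_of_mulVec_eq_zero hA hAd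
    (x := x + (1 / 2 : ℝ) • (y - x)) (u := (b - A *ᵥ x) ᵥ* A) ⟨_, rfl⟩ ?_ ?_)).symm
  · refine h.mem_subdiff_iff.2 ⟨hmP, fun q hq => ?_⟩
    rw [hFm, ← sub_sub, dotProduct_sub _ (q - x), dotProduct_smul, hu0, smul_zero, sub_zero]
    exact hx' q hq
  · intro g hg
    obtain ⟨_, hg⟩ := h.mem_subdiff_iff.1 hg
    have h1 := hg y hyP
    have h2 := hg x hxP
    rw [hym, hFm, dotProduct_smul, smul_eq_mul] at h1
    rw [hxm, hFm, dotProduct_neg, dotProduct_smul, smul_eq_mul] at h2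
    linarith

/-- A map selecting unique minimizers is continuous. -/
theorem continuous_of_solSet_eq (h : MaxAffineRep f v w a β F P) {A : Matrix (Fin m) (Fin n) ℝ}
    {s : (Fin m → ℝ) → Fin n → ℝ} (hs : ∀ b, solSet lsq A f b = {s b}) : Continuous s := by
  have hmem : ∀ b, s b ∈ P ∧ ∀ y ∈ P, lsq (A *ᵥ s b) b + F (s b) ≤ lsq (A *ᵥ y) b + F y :=
    fun b => h.mem_solSet_iff.1 (by rw [hs b]; rfl)
  rw [continuous_iff_continuousAt]
  intro b
  rw [ContinuousAt, Metric.tendsto_nhds]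
  intro r hr
  have hK : IsCompact (Metric.sphere (s b) r ∩ P) := (isCompact_sphere _ _).inter_right h.isClosed
  have hF := h.continuous_val
  have hev : ∀ᶠ b' in 𝓝 b, ∀ y ∈ Metric.sphere (s b) r ∩ P,
      lsq (A *ᵥ s b) b' + F (s b) < lsq (A *ᵥ y) b' + F y := by
    refine hK.eventually_forall_of_forall_eventually fun y hy => ?_
    refine ContinuousAt.eventually_lt (x₀ := (b, y))
      (f := fun q : (Fin m → ℝ) × (Fin n → ℝ) => lsq (A *ᵥ s b) q.1 + F (s b))
      (g := fun q : (Fin m → ℝ) × (Fin n → ℝ) => lsq (A *ᵥ q.2) q.1 + F q.2)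
      (Continuous.continuousAt ?_) (Continuous.continuousAt ?_) ?_
    · unfold lsq
      fun_prop
    · unfold lsq
      fun_prop
    · by_contra! hle
      have : y ∈ solSet lsq A f b :=
        h.mem_solSet_iff.2 ⟨hy.2, fun q hq => hle.trans ((hmem b).2 q hq)⟩
      rw [hs b, Set.mem_singleton_iff] at this
      have hdist := hy.1
      rw [this, Metric.mem_sphere, dist_self] at hdist
      exact hr.ne hdist
  filter_upwards [hev] with b' hb'
  by_contra! hge
  have hpos : 0 < dist (s b') (s b) := hr.trans_le hge
  set t := r / dist (s b') (s b) with ht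
  have ht0 : 0 < t := div_pos hr hpos
  have ht1 : t ≤ 1 := (div_le_one hpos).2 hge
  have hyP := h.mem_of_add_mem (hmem b).1 (hmem b').1 ht0.le ht1
  have h1 := hb' (s b + t • (s b' - s b)) ⟨by
    rw [Metric.mem_sphere, dist_eq_norm, add_sub_cancel_left, norm_smul, ← dist_eq_norm,
      Real.norm_of_nonneg ht0.le, ht, div_mul_cancel₀ _ hpos.ne'], hyP⟩
  have h2 := h.val_add_le (s b) (s b') ht0.le ht1
  have h3 := (hmem b').2 _ (hmem b).1
  have h4 : lsq (A *ᵥ (s b + t • (s b' - s b))) b' ≤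
      lsq (A *ᵥ s b) b' + t * (lsq (A *ᵥ s b') b' - lsq (A *ᵥ s b) b') := by
    rw [mulVec_add, mulVec_smul, mulVec_sub]
    exact lsq_add_smul_le _ _ _ ht0.le ht1
  nlinarith

end MaxAffineRep

end

/-- Necessary and sufficient conditions for well-posedness of sparse regularized
linear least squares (Theorem 1.1). -/
theorem wellPosedness_iff {n m : ℕ} (hn : 1 ≤ n) (hm : 1 ≤ m)
    (A : Matrix (Fin m) (Fin n) ℝ) (f : (Fin n → ℝ) → EReal) (hf : IsCPWL f)
    (hdom : affineSpan ℝ {x : Fin n → ℝ | f x < ⊤} = ⊤) :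
    (∃ s : (Fin m → ℝ) → (Fin n → ℝ), Continuous s ∧
        ∀ b : Fin m → ℝ, solSet lsq A f b = {s b}) ↔
      ((∀ b : Fin m → ℝ, (solSet lsq A f b).Nonempty) ∧
        ∀ x : Fin n → ℝ, (rowSpace A ∩ subdiff f x).Nonempty →
          nullity A ≤ setDim (subdiff f x)) := by
  obtain ⟨k, l, v, w, a, β, F, P, h⟩ := hf.exists_maxAffineRep hdom
  constructor
  · rintro ⟨s, -, hs⟩
    exact ⟨fun b => hs b ▸ Set.singleton_nonempty _, fun x hx => h.nullity_le_of_subsingleton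
      (fun b => hs b ▸ Set.subsingleton_singleton) hx⟩
  · rintro ⟨hne, hA⟩
    choose s hs using hne
    have hs' : ∀ b, solSet lsq A f b = {s b} :=
      fun b => (h.solSet_subsingleton hA b).eq_singleton_of_mem (hs b)
    exact ⟨s, h.continuous_of_solSet_eq hs', hs'⟩

end
end

section
/- Let f : ℝ^n → ℝ ∪ {+∞} be convex piecewise linear and let x ∈ ℝ^n with f(x) < +∞. Then the closure F of the set R = {y ∈ ℝ^n | ∂f(y) = ∂f(x)} is a polyhedral set (a finite intersection of closed halfspaces), and R equals the relative interior of F (the interior of F within its affine hull). -/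
noncomputable section

open Filter Topology

/-- The points at which the affine functions `g k` are nonpositive and exactly those vanish
that vanish at `x`. -/
def sameActive {ι E : Type*} [AddCommGroup E] [Module ℝ E] (g : ι → E →ᵃ[ℝ] ℝ) (x : E) : Set E :=
  {y | ∀ k, g k y ≤ 0 ∧ (g k y = 0 ↔ g k x = 0)}

/-- The points at which the affine functions `g k` are nonpositive and those that vanish at `x`
vanish. -/
def moreActive {ι E : Type*} [AddCommGroup E] [Module ℝ E] (g : ι → E →ᵃ[ℝ] ℝ) (x : E) : Set E :=
  {y | ∀ k, g k y ≤ 0 ∧ (g k x = 0 → g k y = 0)}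

section Faces

variable {ι E : Type*} [NormedAddCommGroup E] [NormedSpace ℝ E]
  {g : ι → E →ᵃ[ℝ] ℝ} {x : E}

theorem affineMap_apply_lineMap (h : E →ᵃ[ℝ] ℝ) (x y : E) (t : ℝ) :
    h (AffineMap.lineMap x y t) = (1 - t) * h x + t * h y := by
  rw [AffineMap.apply_lineMap, AffineMap.lineMap_apply_module]
  simp

theorem closure_sameActive [FiniteDimensional ℝ E] (hx : ∀ k, g k x ≤ 0) :
    closure (sameActive g x) = moreActive g x := by
  have hc (k : ι) : Continuous (g k) := (g k).continuous_of_finiteDimensional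
  apply subset_antisymm
  · apply closure_minimal
    · exact fun y hy k => ⟨(hy k).1, (hy k).2.2⟩
    · have : moreActive g x = ⋂ k, {y | g k y ≤ 0} ∩ {y | g k x = 0 → g k y = 0} := by
        ext y; simp [moreActive]
      rw [this]
      refine isClosed_iInter fun k => (isClosed_le (hc k) continuous_const).inter ?_
      by_cases h : g k x = 0
      · simpa [h] using isClosed_eq (hc k) continuous_const
      · simp [h]
  · intro y hy
    have hlim : Tendsto (fun t : ℝ => AffineMap.lineMap x y t) (𝓝[<] 1) (𝓝 y) := by
      have : Continuous fun t : ℝ => (AffineMap.lineMap x y t : E) :=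
        AffineMap.lineMap_continuous
      simpa using (this.tendsto 1).mono_left nhdsWithin_le_nhds
    refine mem_closure_of_tendsto hlim ?_
    filter_upwards [Ioo_mem_nhdsLT (show (0 : ℝ) < 1 by norm_num)] with t ht k
    rw [affineMap_apply_lineMap]
    obtain ⟨h1, h2⟩ := hy k
    have h3 := hx k
    have h4 : 0 < 1 - t := by linarith [ht.2]
    have h5 : t * g k y ≤ 0 := mul_nonpos_of_nonneg_of_nonpos ht.1.le h1
    refine ⟨by nlinarith, fun h => by nlinarith, fun h => by simp [h, h2 h]⟩

theorem intrinsicInterior_moreActive [Finite ι] [FiniteDimensional ℝ E] (hx : ∀ k, g k x ≤ 0) :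
    intrinsicInterior ℝ (moreActive g x) = sameActive g x := by
  have hc (k : ι) : Continuous (g k) := (g k).continuous_of_finiteDimensional
  have hxF : x ∈ moreActive g x := fun k => ⟨hx k, id⟩
  apply subset_antisymm
  · rintro _ ⟨y, hy, rfl⟩
    have hyF : (y : E) ∈ moreActive g x :=
      interior_subset (s := Subtype.val ⁻¹' moreActive g x) hy
    refine fun k => ⟨(hyF k).1, fun h0 => ?_, (hyF k).2⟩
    let x' : affineSpan ℝ (moreActive g x) := ⟨x, subset_affineSpan ℝ _ hxF⟩
    let γ : ℝ → affineSpan ℝ (moreActive g x) := fun t =>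
      ⟨AffineMap.lineMap x (y : E) t, AffineMap.lineMap_mem t x'.2 y.2⟩
    have hγ : Continuous γ := Continuous.subtype_mk AffineMap.lineMap_continuous _
    have hγ1 : γ 1 = y := Subtype.ext (by simp [γ])
    have hev : ∀ᶠ t in 𝓝[>] (1 : ℝ), (γ t : E) ∈ moreActive g x := by
      have := hγ.tendsto 1
      rw [hγ1] at this
      exact (this.mono_left nhdsWithin_le_nhds).eventually (mem_interior_iff_mem_nhds.1 hy)
    obtain ⟨t, ht, ht1⟩ := (hev.and self_mem_nhdsWithin).exists
    have h1 := (ht k).1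
    simp only [γ, affineMap_apply_lineMap, h0] at h1
    have h2 := hx k
    have h3 : (1 : ℝ) < t := ht1
    nlinarith
  · intro y hy
    have hyF : y ∈ moreActive g x := fun k => ⟨(hy k).1, (hy k).2.2⟩
    refine ⟨⟨y, subset_affineSpan ℝ _ hyF⟩, ?_, rfl⟩
    rw [mem_interior_iff_mem_nhds]
    have hspan (z : affineSpan ℝ (moreActive g x)) (k : ι) (hk : g k x = 0) : g k z = 0 := by
      have hle : affineSpan ℝ (moreActive g x) ≤
          (AffineSubspace.mk' (0 : ℝ) ⊥).comap (g k) :=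
        affineSpan_le.2 fun u hu => by simpa [AffineSubspace.mem_mk'] using (hu k).2 hk
      simpa [AffineSubspace.mem_mk'] using hle z.2
    have hev : ∀ᶠ z : affineSpan ℝ (moreActive g x) in 𝓝 ⟨y, subset_affineSpan ℝ _ hyF⟩,
        ∀ k, g k x ≠ 0 → g k z < 0 := by
      refine eventually_all.2 fun k => ?_
      by_cases hk : g k x = 0
      · simp [hk]
      · have hlt : g k y < 0 := lt_of_le_of_ne (hy k).1 fun h => hk ((hy k).2.1 h)
        have := (((hc k).comp continuous_subtype_val).tendsto
          (⟨y, subset_affineSpan ℝ _ hyF⟩ : affineSpan ℝ (moreActive g x))).eventually_lt_const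
            hlt
        filter_upwards [this] with z hz _ using hz
    filter_upwards [hev] with z hz k
    refine ⟨?_, hspan z k⟩
    by_cases hk : g k x = 0
    · exact (hspan z k hk).le
    · exact (hz k hk).le

end Faces

theorem isPolyhedron_setOf_forall_affineMap_le {n : ℕ} {ι : Type*} [Finite ι]
    (g : ι → (Fin n → ℝ) →ᵃ[ℝ] ℝ) : IsPolyhedron {y | ∀ k, g k y ≤ 0} := by
  obtain ⟨m, ⟨e⟩⟩ := Finite.exists_equiv_fin ι
  refine ⟨m, fun i j => (g (e.symm i)).linear (Pi.single j 1), fun i => - g (e.symm i) 0, ?_⟩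
  ext y
  have key (k : ι) : g k y = ∑ j, (g k).linear (Pi.single j 1) * y j + g k 0 := by
    have h := congrFun (g k).decomp y
    rw [h, Pi.add_apply, LinearMap.pi_apply_eq_sum_univ]
    simp only [smul_eq_mul, mul_comm, add_left_inj]
    refine Finset.sum_congr rfl fun j _ => ?_
    congr 2
    ext i
    simp [Pi.single_apply, eq_comm]
  rw [Set.mem_ofPred_eq, Set.mem_ofPred_eq, ← e.symm.forall_congr_right]
  refine forall_congr' fun i => ?_
  rw [key]
  constructor <;> intro h <;> linarith

theorem isPolyhedron_moreActive {n : ℕ} {ι : Type*} [Finite ι]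
    (g : ι → (Fin n → ℝ) →ᵃ[ℝ] ℝ) (x : Fin n → ℝ) : IsPolyhedron (moreActive g x) := by
  convert isPolyhedron_setOf_forall_affineMap_le
    (Sum.elim g fun k : {k // g k x = 0} => -g k) using 1
  ext y
  simp only [moreActive, Set.mem_ofPred_eq, Sum.forall, Sum.elim_inl, Sum.elim_inr,
    Subtype.forall, AffineMap.coe_neg, Pi.neg_apply, Left.neg_nonpos_iff]
  exact ⟨fun h => ⟨fun k => (h k).1, fun k hk => ((h k).2 hk).ge⟩,
    fun h k => ⟨h.1 k, fun hk => le_antisymm (h.1 k) (h.2 k hk)⟩⟩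

/-- The pointwise maximum of finitely many affine functions. -/
def maxAffine {n k : ℕ} (v : Fin (k + 1) → Fin n → ℝ) (w : Fin (k + 1) → ℝ) (x : Fin n → ℝ) : ℝ :=
  Finset.univ.sup' Finset.univ_nonempty fun i => v i ⬝ᵥ x + w i

section MaxAffine

variable {n k m : ℕ} {v : Fin (k + 1) → Fin n → ℝ} {w : Fin (k + 1) → ℝ}
  {a : Fin m → Fin n → ℝ} {β : Fin m → ℝ} {f : (Fin n → ℝ) → EReal} {x y : Fin n → ℝ}

theorem le_maxAffine (i : Fin (k + 1)) : v i ⬝ᵥ x + w i ≤ maxAffine v w x :=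
  Finset.le_sup' (fun i => v i ⬝ᵥ x + w i) (Finset.mem_univ i)

theorem exists_eq_maxAffine (v : Fin (k + 1) → Fin n → ℝ) (w : Fin (k + 1) → ℝ) (x : Fin n → ℝ) :
    ∃ i, v i ⬝ᵥ x + w i = maxAffine v w x := by
  obtain ⟨i, -, hi⟩ := Finset.exists_mem_eq_sup' (s := Finset.univ) Finset.univ_nonempty
    (fun i => v i ⬝ᵥ x + w i)
  exact ⟨i, hi.symm⟩

theorem mem_subdiff_iff_of_mem {P : Set (Fin n → ℝ)} (hf : ∀ x ∈ P, f x = (maxAffine v w x : ℝ))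
    (hf' : ∀ x ∉ P, f x = ⊤) (hx : x ∈ P) {u : Fin n → ℝ} :
    u ∈ subdiff f x ↔ ∀ z ∈ P, maxAffine v w x + u ⬝ᵥ (z - x) ≤ maxAffine v w z := by
  refine forall_congr' fun z => ?_
  by_cases hz : z ∈ P
  · rw [hf x hx, hf z hz]
    norm_cast
    simp [hz, dotProduct]
  · simp [hf' z hz, hz]

theorem subdiff_eq_empty_of_eq_top (hx : f x ≠ ⊤) (hy : f y = ⊤) : subdiff f y = ∅ := by
  refine Set.eq_empty_of_forall_notMem fun u hu => hx ?_
  have h := hu x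
  rw [hy, EReal.top_add_coe] at h
  exact top_le_iff.1 h

/-- Subdifferentials of a convex piecewise linear function are nested exactly when the sets of
active affine pieces and active constraints are. -/
theorem subdiff_subset_subdiff_iff
    (hf : ∀ x ∈ {x | ∀ j, a j ⬝ᵥ x ≤ β j}, f x = (maxAffine v w x : ℝ))
    (hf' : ∀ x ∉ {x | ∀ j, a j ⬝ᵥ x ≤ β j}, f x = ⊤)
    (hx : ∀ j, a j ⬝ᵥ x ≤ β j) (hy : ∀ j, a j ⬝ᵥ y ≤ β j) :
    subdiff f x ⊆ subdiff f y ↔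
      (∀ i, v i ⬝ᵥ x + w i = maxAffine v w x → v i ⬝ᵥ y + w i = maxAffine v w y) ∧
      (∀ j, a j ⬝ᵥ x = β j → a j ⬝ᵥ y = β j) := by
  have hmemx {u} := mem_subdiff_iff_of_mem hf hf' hx (u := u)
  have hmemy {u} := mem_subdiff_iff_of_mem hf hf' hy (u := u)
  constructor
  · intro h
    have hv (i) (hi : v i ⬝ᵥ x + w i = maxAffine v w x) : v i ∈ subdiff f x := by
      refine hmemx.2 fun z _ => ?_
      have := le_maxAffine (v := v) (w := w) (x := z) i
      rw [dotProduct_sub]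
      linarith
    have hI (i) (hi : v i ⬝ᵥ x + w i = maxAffine v w x) :
        v i ⬝ᵥ y + w i = maxAffine v w y := by
      have h1 := hmemy.1 (h (hv i hi)) x hx
      have := le_maxAffine (v := v) (w := w) (x := y) i
      rw [dotProduct_sub] at h1
      linarith
    refine ⟨hI, fun j hj => le_antisymm (hy j) ?_⟩
    obtain ⟨i, hi⟩ := exists_eq_maxAffine v w x
    have h1 : v i + a j ∈ subdiff f x := by
      refine hmemx.2 fun z hz => ?_
      have h2 := hmemx.1 (hv i hi) z hz
      have h3 := hz j
      rw [add_dotProduct, dotProduct_sub (a j)]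
      linarith
    have h2 := hmemy.1 (h h1) x hx
    have h3 := hI i hi
    rw [add_dotProduct, dotProduct_sub, dotProduct_sub] at h2
    linarith
  · rintro ⟨hI, hJ⟩ u hu
    rw [hmemy]
    intro z hz
    set d := z - y with hd
    have e1 : ∀ᶠ t in 𝓝[>] (0 : ℝ), ∀ j, a j ⬝ᵥ (x + t • d) ≤ β j := by
      refine eventually_all.2 fun j => ?_
      by_cases hj : a j ⬝ᵥ x = β j
      · filter_upwards [self_mem_nhdsWithin] with t (ht : 0 < t)
        have h1 := hJ j hj
        have h2 := hz j
        rw [dotProduct_add, dotProduct_smul, hj, hd, dotProduct_sub, h1, smul_eq_mul]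
        nlinarith
      · have hlt := lt_of_le_of_ne (hx j) hj
        have hc : Continuous fun t : ℝ => a j ⬝ᵥ x + t * (a j ⬝ᵥ d) := by fun_prop
        have := ((hc.tendsto 0).mono_left (nhdsWithin_le_nhds (s := Set.Ioi 0))).eventually_lt_const
          (u := β j) (by simpa using hlt)
        filter_upwards [this] with t ht
        rw [dotProduct_add, dotProduct_smul, smul_eq_mul]
        exact ht.le
    have e2 : ∀ᶠ t in 𝓝[>] (0 : ℝ), ∀ i, v i ⬝ᵥ x + w i ≠ maxAffine v w x →
        v i ⬝ᵥ (x + t • d) + w i < maxAffine v w x + u ⬝ᵥ (x + t • d - x) := by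
      refine eventually_all.2 fun i => ?_
      by_cases hi : v i ⬝ᵥ x + w i = maxAffine v w x
      · simp [hi]
      · have hlt := lt_of_le_of_ne (le_maxAffine i) hi
        have hc : Continuous fun t : ℝ => v i ⬝ᵥ x + t * (v i ⬝ᵥ d) + w i - t * (u ⬝ᵥ d) := by
          fun_prop
        have := ((hc.tendsto 0).mono_left (nhdsWithin_le_nhds (s := Set.Ioi 0))).eventually_lt_const
          (u := maxAffine v w x) (by simpa using hlt)
        filter_upwards [this] with t ht _
        rw [add_sub_cancel_left, dotProduct_add, dotProduct_smul, dotProduct_smul, smul_eq_mul,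
          smul_eq_mul]
        linarith
    obtain ⟨t, ⟨h1, h2⟩, ht⟩ := ((e1.and e2).and self_mem_nhdsWithin).exists
    replace ht : 0 < t := ht
    have h3 := hmemx.1 hu _ h1
    obtain ⟨i, hi⟩ := exists_eq_maxAffine v w (x + t • d)
    have hix : v i ⬝ᵥ x + w i = maxAffine v w x := by
      by_contra hne
      have := h2 i hne
      linarith
    have hiy := hI i hix
    rw [← hi, add_sub_cancel_left, dotProduct_add, dotProduct_smul, dotProduct_smul, smul_eq_mul,
      smul_eq_mul] at h3
    have h4 : u ⬝ᵥ d ≤ v i ⬝ᵥ d := le_of_mul_le_mul_left (by linarith) ht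
    have h5 := le_maxAffine (v := v) (w := w) (x := z) i
    have h6 : v i ⬝ᵥ d = v i ⬝ᵥ z - v i ⬝ᵥ y := by rw [hd, dotProduct_sub]
    linarith

/-- The affine function `y ↦ c ⬝ᵥ y + b`. -/
def dotAffine (c : Fin n → ℝ) (b : ℝ) : (Fin n → ℝ) →ᵃ[ℝ] ℝ :=
  (dotProductBilin ℝ ℝ c).toAffineMap + AffineMap.const ℝ _ b

@[simp]
theorem dotAffine_apply (c : Fin n → ℝ) (b : ℝ) (y : Fin n → ℝ) :
    dotAffine c b y = c ⬝ᵥ y + b := rfl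

theorem setOf_subdiff_eq_eq_sameActive
    (hf : ∀ x ∈ {x | ∀ j, a j ⬝ᵥ x ≤ β j}, f x = (maxAffine v w x : ℝ))
    (hf' : ∀ x ∉ {x | ∀ j, a j ⬝ᵥ x ≤ β j}, f x = ⊤)
    (hx : ∀ j, a j ⬝ᵥ x ≤ β j) {i₀ : Fin (k + 1)} (hi₀ : v i₀ ⬝ᵥ x + w i₀ = maxAffine v w x) :
    {y | subdiff f y = subdiff f x} =
      sameActive (Sum.elim (fun i => dotAffine (v i) (w i) - dotAffine (v i₀) (w i₀))
        fun j => dotAffine (a j) (-β j)) x := by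
  ext y
  simp only [sameActive, Set.mem_ofPred_eq, Sum.forall, Sum.elim_inl, Sum.elim_inr,
    AffineMap.coe_sub, Pi.sub_apply, dotAffine_apply, sub_nonpos, sub_eq_zero, ← sub_eq_add_neg]
  rw [hi₀]
  by_cases hy : ∀ j, a j ⬝ᵥ y ≤ β j
  · rw [Set.Subset.antisymm_iff, subdiff_subset_subdiff_iff hf hf' hx hy,
      subdiff_subset_subdiff_iff hf hf' hy hx]
    constructor
    · rintro ⟨⟨h1, h2⟩, h3, h4⟩
      rw [h3 i₀ hi₀]
      exact ⟨fun i => ⟨le_maxAffine i, h1 i, h3 i⟩, fun j => ⟨hy j, h2 j, h4 j⟩⟩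
    · rintro ⟨h1, h2⟩
      have h3 : v i₀ ⬝ᵥ y + w i₀ = maxAffine v w y :=
        le_antisymm (le_maxAffine i₀) (Finset.sup'_le _ _ fun i _ => (h1 i).1)
      rw [h3] at h1
      exact ⟨⟨fun i => (h1 i).2.1, fun j => (h2 j).2.1⟩, fun i => (h1 i).2.2, fun j => (h2 j).2.2⟩
  · refine iff_of_false (fun h => ?_) fun h => hy fun j => (h.2 j).1
    have hne : f x ≠ ⊤ := by rw [hf x hx]; exact EReal.coe_ne_top _
    rw [subdiff_eq_empty_of_eq_top hne (hf' y hy)] at h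
    have hv : v i₀ ∈ subdiff f x := by
      refine (mem_subdiff_iff_of_mem hf hf' hx).2 fun z _ => ?_
      have := le_maxAffine (v := v) (w := w) (x := z) i₀
      rw [dotProduct_sub]
      linarith
    simp [← h] at hv

end MaxAffine

/-- The closure of a set of constant subdifferential of a convex piecewise linear
function is polyhedral, and the set itself is the relative interior of its closure. -/
theorem closure_constantSubdiff_polyhedron {n : ℕ} (f : (Fin n → ℝ) → EReal)
    (hf : IsCPWL f) (x : Fin n → ℝ) (hx : f x < ⊤) :
    IsPolyhedron (closure {y : Fin n → ℝ | subdiff f y = subdiff f x}) ∧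
    {y : Fin n → ℝ | subdiff f y = subdiff f x} =
      intrinsicInterior ℝ (closure {y : Fin n → ℝ | subdiff f y = subdiff f x}) := by
  obtain ⟨k, v, w, P, ⟨m, a, β, rfl⟩, hf, hf'⟩ := hf
  have hxP : ∀ j, a j ⬝ᵥ x ≤ β j := by
    by_contra h
    exact hx.ne (hf' x h)
  obtain ⟨i₀, hi₀⟩ := exists_eq_maxAffine v w x
  rw [setOf_subdiff_eq_eq_sameActive hf hf' hxP hi₀]
  set g := Sum.elim (fun i => dotAffine (v i) (w i) - dotAffine (v i₀) (w i₀))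
    fun j => dotAffine (a j) (-β j) with hg
  have hle : ∀ k, g k x ≤ 0 := by
    rintro (i | j)
    · simpa [hg, hi₀] using le_maxAffine i
    · simpa [hg] using hxP j
  rw [closure_sameActive hle, intrinsicInterior_moreActive hle]
  exact ⟨isPolyhedron_moreActive _ _, rfl⟩

end
end

section
/- Let f : ℝ^n → ℝ ∪ {+∞} be convex piecewise linear, let x ∈ ℝ^n with f(x) < +∞, and let y lie in the relative interior of ∂f(x) (in particular ∂f(x) ≠ ∅). Define the convex conjugate f*(w) = sup_{z ∈ ℝ^n} ( wᵀz − f(z) ) ∈ ℝ ∪ {+∞}, and define ∂f*(y) = {z ∈ ℝ^n | f*(w) ≥ f*(y) + zᵀ(w − y) for all w ∈ ℝ^n}. Then ∂f*(y) equals the closure of the set {z ∈ ℝ^n | ∂f(z) = ∂f(x)}. -/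
noncomputable section

/-- From a relative interior point one can move slightly away from any other point of the set. -/
lemma exists_pos_lineMap_neg_mem_of_mem_intrinsicInterior {E : Type*} [NormedAddCommGroup E]
    [NormedSpace ℝ E] {S : Set E} {y v : E} (hy : y ∈ intrinsicInterior ℝ S) (hv : v ∈ S) :
    ∃ ε : ℝ, 0 < ε ∧ AffineMap.lineMap y v (-ε) ∈ S := by
  obtain ⟨y', hy', rfl⟩ := mem_intrinsicInterior.1 hy
  let φ : ℝ → affineSpan ℝ S := fun t =>
    ⟨AffineMap.lineMap (y' : E) v (-t),
      AffineMap.lineMap_mem _ y'.2 (subset_affineSpan ℝ S hv)⟩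
  have hφ : Continuous φ := by
    refine Continuous.subtype_mk ?_ _
    exact AffineMap.lineMap_continuous.comp continuous_neg
  have hφ0 : φ 0 = y' := by
    ext
    simp [φ]
  have hev : ∀ᶠ t in nhds (0 : ℝ), φ t ∈ interior ((↑) ⁻¹' S : Set (affineSpan ℝ S)) :=
    hφ.continuousAt.eventually_mem (by rw [hφ0]; exact isOpen_interior.mem_nhds hy')
  obtain ⟨ε, hε, hpos⟩ :=
    ((hev.filter_mono nhdsWithin_le_nhds).and
      (self_mem_nhdsWithin : Set.Ioi (0 : ℝ) ∈ nhdsWithin 0 (Set.Ioi 0))).exists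
  have hεS : φ ε ∈ ((↑) ⁻¹' S : Set (affineSpan ℝ S)) := interior_subset hε
  exact ⟨ε, hpos, hεS⟩

lemma mem_subdiff_iff_of_eq_coe {n : ℕ} {f : (Fin n → ℝ) → EReal} {x : Fin n → ℝ} {r : ℝ}
    (hr : f x = r) {v : Fin n → ℝ} :
    v ∈ subdiff f x ↔ ∀ z, ((r + v ⬝ᵥ (z - x) : ℝ) : EReal) ≤ f z := by
  simp only [subdiff, Set.mem_ofPred_eq, hr, EReal.coe_add]
  rfl

lemma exists_eq_coe_of_mem_subdiff {n : ℕ} {f : (Fin n → ℝ) → EReal} {x z v : Fin n → ℝ}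
    (hbot : f z ≠ ⊥) (hx : f x ≠ ⊤) (hv : v ∈ subdiff f z) : ∃ s : ℝ, f z = s := by
  refine ⟨(f z).toReal, (EReal.coe_toReal (fun htop => hx ?_) hbot).symm⟩
  simpa [htop] using hv x

/-- If `u` attains equality in the subgradient inequality of `v` at `x`, then `v` is a
subgradient at `u`. -/
lemma mem_subdiff_of_le {n : ℕ} {f : (Fin n → ℝ) → EReal} {x u v : Fin n → ℝ} {r s : ℝ}
    (hr : f x = r) (hs : f u = s) (hv : v ∈ subdiff f x) (h : s ≤ r + v ⬝ᵥ (u - x)) :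
    v ∈ subdiff f u := by
  rw [mem_subdiff_iff_of_eq_coe hs]
  intro z
  refine le_trans ?_ ((mem_subdiff_iff_of_eq_coe hr).1 hv z)
  rw [EReal.coe_le_coe_iff]
  simp only [dotProduct_sub] at h ⊢
  linarith

/-- The Fenchel equality at a subgradient. -/
lemma conjugate_eq_of_mem_subdiff {n : ℕ} {f fstar : (Fin n → ℝ) → EReal}
    (hfstar : ∀ w, fstar w = ⨆ z : Fin n → ℝ, (((w ⬝ᵥ z : ℝ) : EReal) - f z))
    {x v : Fin n → ℝ} {r : ℝ} (hr : f x = r) (hv : v ∈ subdiff f x) :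
    fstar v = ((v ⬝ᵥ x - r : ℝ) : EReal) := by
  rw [hfstar]
  apply le_antisymm
  · refine iSup_le fun z => ?_
    have hz := (mem_subdiff_iff_of_eq_coe hr).1 hv z
    induction hfz : f z with
    | bot => exact absurd (hfz ▸ hz) (by simp [-EReal.coe_add])
    | top => simp
    | coe s =>
      rw [hfz, EReal.coe_le_coe_iff, dotProduct_sub] at hz
      rw [← EReal.coe_sub, EReal.coe_le_coe_iff]
      linarith
  · refine le_iSup_of_le x ?_
    rw [hr, EReal.coe_sub]

lemma IsCPWL.ne_bot {n : ℕ} {f : (Fin n → ℝ) → EReal} (hf : IsCPWL f) (z : Fin n → ℝ) :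
    f z ≠ ⊥ := by
  obtain ⟨k, v, w, P, -, hfP, hfP'⟩ := hf
  by_cases hz : z ∈ P
  · simp [hfP z hz]
  · simp [hfP' z hz]

/-- A convex piecewise linear function has a subgradient at every point of its domain. -/
lemma IsCPWL.subdiff_nonempty {n : ℕ} {f : (Fin n → ℝ) → EReal} (hf : IsCPWL f)
    {z : Fin n → ℝ} (hz : f z ≠ ⊤) : (subdiff f z).Nonempty := by
  obtain ⟨k, v, w, P, -, hfP, hfP'⟩ := hf
  have hzP : z ∈ P := by_contra fun h => hz (hfP' z h)
  obtain ⟨i, -, hi⟩ := Finset.exists_mem_eq_sup' Finset.univ_nonempty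
    fun i => ∑ j, v i j * z j + w i
  refine ⟨v i, (mem_subdiff_iff_of_eq_coe (hfP z hzP)).2 fun u => ?_⟩
  by_cases hu : u ∈ P
  · rw [hfP u hu, EReal.coe_le_coe_iff, hi]
    refine le_trans (le_of_eq ?_)
      (Finset.le_sup' (fun i => ∑ j, v i j * u j + w i) (Finset.mem_univ i))
    change v i ⬝ᵥ z + w i + v i ⬝ᵥ (u - z) = v i ⬝ᵥ u + w i
    rw [dotProduct_sub]
    ring
  · simp [hfP' u hu]

/-- Outside the domain of a convex piecewise linear function there is a separating halfspace. -/
lemma IsCPWL.exists_halfspace {n : ℕ} {f : (Fin n → ℝ) → EReal} (hf : IsCPWL f)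
    {z : Fin n → ℝ} (hz : f z = ⊤) :
    ∃ (a : Fin n → ℝ) (β : ℝ), β < a ⬝ᵥ z ∧ ∀ u, f u ≠ ⊤ → a ⬝ᵥ u ≤ β := by
  obtain ⟨k, v, w, P, ⟨m, a, β, rfl⟩, hfP, hfP'⟩ := hf
  have hzP : ¬ ∀ i, ∑ j, a i j * z j ≤ β i := fun h => by
    have := hfP z h
    rw [hz] at this
    exact EReal.coe_ne_top _ this.symm
  push Not at hzP
  obtain ⟨i, hi⟩ := hzP
  refine ⟨a i, β i, hi, fun u hu => ?_⟩
  have huP : u ∈ {x : Fin n → ℝ | ∀ i, ∑ j, a i j * x j ≤ β i} :=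
    by_contra fun h => hu (hfP' u h)
  exact huP i

/-- For convex piecewise linear `f`, the subdifferentials of `f` and of its conjugate are inverse
to each other. -/
lemma IsCPWL.mem_subdiff_conjugate_iff {n : ℕ} {f fstar : (Fin n → ℝ) → EReal} (hf : IsCPWL f)
    (hfstar : ∀ w, fstar w = ⨆ z : Fin n → ℝ, (((w ⬝ᵥ z : ℝ) : EReal) - f z))
    {x y : Fin n → ℝ} (hx : f x ≠ ⊤) (hy : y ∈ subdiff f x) (z : Fin n → ℝ) :
    z ∈ subdiff fstar y ↔ y ∈ subdiff f z := by
  obtain ⟨r, hr⟩ := exists_eq_coe_of_mem_subdiff (hf.ne_bot x) hx hy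
  rw [mem_subdiff_iff_of_eq_coe (conjugate_eq_of_mem_subdiff hfstar hr hy)]
  constructor
  · intro h
    by_cases hz : f z = ⊤
    · obtain ⟨a, β, haz, ha⟩ := hf.exists_halfspace hz
      have hle : fstar (y + a) ≤ ((y ⬝ᵥ x - r + β : ℝ) : EReal) := by
        rw [hfstar]
        refine iSup_le fun u => ?_
        have hu := (mem_subdiff_iff_of_eq_coe hr).1 hy u
        induction hfu : f u with
        | bot => exact absurd hfu (hf.ne_bot u)
        | top => simp
        | coe s =>
          have hau := ha u (by simp [hfu])
          rw [hfu, EReal.coe_le_coe_iff, dotProduct_sub] at hu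
          rw [← EReal.coe_sub, EReal.coe_le_coe_iff, add_dotProduct]
          linarith
      have := (h (y + a)).trans hle
      rw [EReal.coe_le_coe_iff, add_sub_cancel_left, dotProduct_comm z a] at this
      linarith
    · obtain ⟨w, hw⟩ := hf.subdiff_nonempty hz
      obtain ⟨s, hs⟩ := exists_eq_coe_of_mem_subdiff (hf.ne_bot z) hx hw
      have := h w
      rw [conjugate_eq_of_mem_subdiff hfstar hs hw, EReal.coe_le_coe_iff, dotProduct_sub,
        dotProduct_comm z w, dotProduct_comm z y] at this
      refine mem_subdiff_of_le hr hs hy ?_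
      rw [dotProduct_sub]
      linarith
  · intro h w
    obtain ⟨s, hs⟩ := exists_eq_coe_of_mem_subdiff (hf.ne_bot z) hx h
    have heq := (conjugate_eq_of_mem_subdiff hfstar hr hy).symm.trans
      (conjugate_eq_of_mem_subdiff hfstar hs h)
    rw [EReal.coe_eq_coe_iff.1 heq, hfstar w]
    refine le_iSup_of_le z ?_
    rw [hs, ← EReal.coe_sub, EReal.coe_le_coe_iff, dotProduct_sub, dotProduct_comm z w,
      dotProduct_comm z y]
    linarith

lemma isClosed_subdiff {n : ℕ} {f : (Fin n → ℝ) → EReal} {x : Fin n → ℝ} {r : ℝ}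
    (hr : f x = r) : IsClosed (subdiff f x) := by
  have : subdiff f x = ⋂ z, {v | ((r + v ⬝ᵥ (z - x) : ℝ) : EReal) ≤ f z} := by
    ext v
    simp only [mem_subdiff_iff_of_eq_coe hr, Set.mem_iInter, Set.mem_ofPred_eq]
  rw [this]
  refine isClosed_iInter fun z => isClosed_le ?_ continuous_const
  exact continuous_coe_real_ereal.comp
    (continuous_const.add (continuous_id.dotProduct continuous_const))

lemma convex_subdiff {n : ℕ} {f : (Fin n → ℝ) → EReal} {x : Fin n → ℝ} {r : ℝ}
    (hr : f x = r) : Convex ℝ (subdiff f x) := by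
  intro v hv w hw a b ha hb hab
  rw [mem_subdiff_iff_of_eq_coe hr] at hv hw ⊢
  intro z
  rcases le_total (v ⬝ᵥ (z - x)) (w ⬝ᵥ (z - x)) with h | h
  · refine le_trans (EReal.coe_le_coe_iff.2 ?_) (hw z)
    simp only [add_dotProduct, smul_dotProduct, smul_eq_mul]
    obtain rfl : b = 1 - a := by linarith
    nlinarith
  · refine le_trans (EReal.coe_le_coe_iff.2 ?_) (hv z)
    simp only [add_dotProduct, smul_dotProduct, smul_eq_mul]
    obtain rfl : a = 1 - b := by linarith
    nlinarith

/-- A relative interior point `y` of `∂f(x)` that is a subgradient at `z` forces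
`∂f(x) ⊆ ∂f(z)`. -/
lemma subdiff_subset_of_mem_intrinsicInterior {n : ℕ} {f : (Fin n → ℝ) → EReal}
    {x y z : Fin n → ℝ} {r s : ℝ} (hr : f x = r) (hs : f z = s)
    (hy : y ∈ intrinsicInterior ℝ (subdiff f x)) (hyz : y ∈ subdiff f z) :
    subdiff f x ⊆ subdiff f z := by
  intro v hv
  obtain ⟨ε, hε, hmem⟩ := exists_pos_lineMap_neg_mem_of_mem_intrinsicInterior hy hv
  refine mem_subdiff_of_le hr hs hv ?_
  have h₁ := (mem_subdiff_iff_of_eq_coe hr).1 hmem z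
  have h₂ := (mem_subdiff_iff_of_eq_coe hs).1 hyz x
  rw [hs, EReal.coe_le_coe_iff, AffineMap.lineMap_apply_module'] at h₁
  rw [hr, EReal.coe_le_coe_iff] at h₂
  simp only [add_dotProduct, smul_dotProduct, smul_eq_mul, sub_dotProduct, dotProduct_sub]
    at h₁ h₂ ⊢
  nlinarith

/-- If `y` is a common subgradient at `x`, `z` and at a point `u` strictly between them, then all
subgradients at `u` are subgradients at `x`. -/
lemma subdiff_subset_of_mem_openSegment {n : ℕ} {f : (Fin n → ℝ) → EReal}
    {x y z u : Fin n → ℝ} {r s t : ℝ} (hr : f x = r) (hs : f z = s) (ht : f u = t)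
    (hu : u ∈ openSegment ℝ x z) (hyx : y ∈ subdiff f x) (hyz : y ∈ subdiff f z)
    (hyu : y ∈ subdiff f u) : subdiff f u ⊆ subdiff f x := by
  intro v hv
  refine mem_subdiff_of_le ht hr hv ?_
  have h₁ := (mem_subdiff_iff_of_eq_coe ht).1 hv z
  have h₂ := (mem_subdiff_iff_of_eq_coe hs).1 hyz x
  have h₃ := (mem_subdiff_iff_of_eq_coe ht).1 hyu x
  have h₄ := (mem_subdiff_iff_of_eq_coe hr).1 hyx u
  obtain ⟨a, b, ha, hb, hab, rfl⟩ := hu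
  obtain rfl : b = 1 - a := by linarith
  rw [hs, EReal.coe_le_coe_iff] at h₁
  rw [hr, EReal.coe_le_coe_iff] at h₂ h₃
  rw [ht, EReal.coe_le_coe_iff] at h₄
  simp only [dotProduct_add, dotProduct_smul, smul_eq_mul, dotProduct_sub] at h₁ h₂ h₃ h₄ ⊢
  have h : a * (v ⬝ᵥ z - v ⬝ᵥ x) ≤ a * (y ⬝ᵥ z - y ⬝ᵥ x) := by linarith
  have h' := mul_le_mul_of_nonneg_left (le_of_mul_le_mul_left h ha) hb.le
  linarith

/-- Duality of complexes: the subdifferential of the convex conjugate at a point in the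
relative interior of `∂f(x)` is the closure of the set of constant subdifferential. -/
theorem subdiff_conjugate_eq_closure {n : ℕ} (f : (Fin n → ℝ) → EReal) (hf : IsCPWL f)
    (x : Fin n → ℝ) (hx : f x < ⊤) (y : Fin n → ℝ)
    (hy : y ∈ intrinsicInterior ℝ (subdiff f x))
    (fstar : (Fin n → ℝ) → EReal)
    (hfstar : ∀ w, fstar w = ⨆ z : Fin n → ℝ, (((∑ j, w j * z j : ℝ) : EReal) - f z)) :
    {z : Fin n → ℝ | ∀ w, fstar y + ((∑ j, z j * (w j - y j) : ℝ) : EReal) ≤ fstar w} =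
      closure {z : Fin n → ℝ | subdiff f z = subdiff f x} := by
  change subdiff fstar y = _
  have hyx := intrinsicInterior_subset hy
  have hmem := hf.mem_subdiff_conjugate_iff hfstar hx.ne hyx
  obtain ⟨r, hr⟩ := exists_eq_coe_of_mem_subdiff (hf.ne_bot x) hx.ne hyx
  have hr' := conjugate_eq_of_mem_subdiff hfstar hr hyx
  apply Set.Subset.antisymm
  · intro z hz
    have hyz := (hmem z).1 hz
    obtain ⟨s, hs⟩ := exists_eq_coe_of_mem_subdiff (hf.ne_bot z) hx.ne hyz
    have hseg : openSegment ℝ x z ⊆ {z | subdiff f z = subdiff f x} := by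
      intro u hu
      have hyu := (hmem u).1
        ((convex_subdiff hr').openSegment_subset ((hmem x).2 hyx) hz hu)
      obtain ⟨t, ht⟩ := exists_eq_coe_of_mem_subdiff (hf.ne_bot u) hx.ne hyu
      exact (subdiff_subset_of_mem_openSegment hr hs ht hu hyx hyz hyu).antisymm
        (subdiff_subset_of_mem_intrinsicInterior hr ht hy hyu)
    exact closure_mono hseg (segment_subset_closure_openSegment (right_mem_segment ℝ x z))
  · refine closure_minimal (fun z hz => (hmem z).2 ?_) (isClosed_subdiff hr')
    exact hz.symm ▸ hyx

end
end

section
/- Let f : ℝ^n → ℝ ∪ {+∞} be convex piecewise linear, A ∈ ℝ^{m×n}, and x ∈ ℝ^n with f(x) < +∞. Let span(∂f(x)) denote the linear subspace of ℝ^n spanned by the elements of ∂f(x), and suppose k := n − dim(span(∂f(x))) − rank(A) > 0. Then there exists a convex set S ⊆ ℝ^n with: x ∈ S; S is contained in the closure of {z | ∂f(z) = ∂f(x)}; dim(S) ≥ k; and for every y ∈ S one has Ay = Ax and f(y) = f(x). -/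
noncomputable section

/-- The vectors orthogonal, for the dot product, to all elements of the subspace `U`. -/
def orthogonalTo {n : ℕ} (U : Submodule ℝ (Fin n → ℝ)) : Submodule ℝ (Fin n → ℝ) :=
  (U.map (dotProductEquiv ℝ (Fin n)).toLinearMap).dualCoannihilator

theorem mem_orthogonalTo {n : ℕ} {U : Submodule ℝ (Fin n → ℝ)} {d : Fin n → ℝ} :
    d ∈ orthogonalTo U ↔ ∀ v ∈ U, v ⬝ᵥ d = 0 := by
  rw [orthogonalTo, Submodule.mem_dualCoannihilator]
  exact Set.forall_mem_image

theorem finrank_orthogonalTo {n : ℕ} (U : Submodule ℝ (Fin n → ℝ)) :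
    Module.finrank ℝ U + Module.finrank ℝ (orthogonalTo U) = n := by
  have h := Subspace.finrank_add_finrank_dualCoannihilator_eq
    (U.map (dotProductEquiv ℝ (Fin n)).toLinearMap)
  rw [LinearEquiv.finrank_map_eq (dotProductEquiv ℝ (Fin n)) U] at h
  rwa [Module.finrank_fin_fun] at h

theorem le_finrank_orthogonalTo_inf_ker {m n : ℕ} (U : Submodule ℝ (Fin n → ℝ))
    (A : Matrix (Fin m) (Fin n) ℝ) :
    n - Module.finrank ℝ U - A.rank ≤
      Module.finrank ℝ ↥(orthogonalTo U ⊓ LinearMap.ker A.mulVecLin) := by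
  have h1 := finrank_orthogonalTo U
  have h2 := LinearMap.finrank_range_add_finrank_ker A.mulVecLin
  have h3 := Submodule.finrank_sup_add_finrank_inf_eq (orthogonalTo U)
    (LinearMap.ker A.mulVecLin)
  have h4 := Submodule.finrank_le (orthogonalTo U ⊔ LinearMap.ker A.mulVecLin)
  rw [Module.finrank_fin_fun] at h2 h4
  change A.rank + _ = n at h2
  omega

/-- A convex piecewise linear function is constant near `x` along the directions orthogonal to
its subdifferential at `x`. -/
theorem IsCPWL.exists_forall_eq_of_mem_orthogonalTo {n : ℕ} {f : (Fin n → ℝ) → EReal}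
    (hf : IsCPWL f) {x : Fin n → ℝ} (hx : f x < ⊤) :
    (∃ c : ℝ, f x = c) ∧ ∃ ε > 0, ∀ y ∈ Metric.ball x ε,
      y - x ∈ orthogonalTo (Submodule.span ℝ (subdiff f x)) → f y = f x := by
  obtain ⟨k, v, w, P, ⟨l, a, β, rfl⟩, hfP, hfn⟩ := hf
  have hxP : ∀ i, a i ⬝ᵥ x ≤ β i := by
    by_contra h
    exact hx.ne (hfn x h)
  set F : (Fin n → ℝ) → ℝ := fun y =>
    Finset.univ.sup' Finset.univ_nonempty fun i => v i ⬝ᵥ y + w i with hF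
  have hfF : ∀ y, (∀ i, a i ⬝ᵥ y ≤ β i) → f y = F y := hfP
  have hfx := hfF x hxP
  have hle : ∀ y i, v i ⬝ᵥ y + w i ≤ F y := fun y i =>
    Finset.le_sup' (fun i => v i ⬝ᵥ y + w i) (Finset.mem_univ i)
  obtain ⟨i₀, -, hi₀⟩ := Finset.exists_mem_eq_sup' Finset.univ_nonempty
    (fun i => v i ⬝ᵥ x + w i)
  change F x = _ at hi₀
  have mem_subdiff : ∀ u, (∀ y, (∀ i, a i ⬝ᵥ y ≤ β i) → F x + u ⬝ᵥ (y - x) ≤ F y) →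
      u ∈ subdiff f x := by
    intro u hu y
    by_cases hy : ∀ i, a i ⬝ᵥ y ≤ β i
    · rw [hfx, hfF y hy, ← EReal.coe_add, EReal.coe_le_coe_iff]
      exact hu y hy
    · rw [hfn y hy]
      exact le_top
  have hv : ∀ i, F x = v i ⬝ᵥ x + w i → v i ∈ subdiff f x := by
    refine fun i hi => mem_subdiff _ fun y _ => ?_
    rw [dotProduct_sub]
    linarith [hle y i]
  have hva : ∀ j, a j ⬝ᵥ x = β j → v i₀ + a j ∈ subdiff f x := by
    refine fun j hj => mem_subdiff _ fun y hy => ?_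
    rw [dotProduct_sub, add_dotProduct, add_dotProduct]
    linarith [hle y i₀, hy j]
  have hvnear : ∀ᶠ y in nhds x, ∀ i, F x ≠ v i ⬝ᵥ x + w i → v i ⬝ᵥ y + w i < F x := by
    refine Filter.eventually_all.2 fun i => Filter.eventually_imp_distrib_left.2 fun hi => ?_
    have hc : Continuous fun y => v i ⬝ᵥ y + w i := by unfold dotProduct; fun_prop
    exact hc.continuousAt.eventually_lt continuousAt_const ((hle x i).lt_of_ne' hi)
  have hanear : ∀ᶠ y in nhds x, ∀ j, a j ⬝ᵥ x ≠ β j → a j ⬝ᵥ y < β j := by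
    refine Filter.eventually_all.2 fun j => Filter.eventually_imp_distrib_left.2 fun hj => ?_
    have hc : Continuous fun y => a j ⬝ᵥ y := by unfold dotProduct; fun_prop
    exact hc.continuousAt.eventually_lt continuousAt_const ((hxP j).lt_of_ne hj)
  obtain ⟨ε, hε, hball⟩ := Metric.eventually_nhds_iff_ball.1 (hvnear.and hanear)
  refine ⟨⟨F x, hfx⟩, ε, hε, fun y hy hyx => ?_⟩
  obtain ⟨hyv, hya⟩ := hball y hy
  have orth : ∀ u ∈ subdiff f x, u ⬝ᵥ y = u ⬝ᵥ x := fun u hu => by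
    rw [← sub_eq_zero, ← dotProduct_sub]
    exact mem_orthogonalTo.1 hyx u (Submodule.subset_span hu)
  have hi₀y := orth _ (hv i₀ hi₀)
  have hyP : ∀ j, a j ⬝ᵥ y ≤ β j := by
    intro j
    by_cases hj : a j ⬝ᵥ x = β j
    · have := orth _ (hva j hj)
      rw [add_dotProduct, add_dotProduct] at this
      linarith
    · exact (hya j hj).le
  rw [hfF y hyP, hfx, EReal.coe_eq_coe_iff]
  refine le_antisymm (Finset.sup'_le _ _ fun i _ => ?_) ?_
  · by_cases hi : F x = v i ⬝ᵥ x + w i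
    · rw [orth _ (hv i hi), hi]
    · exact (hyv i hi).le
  · linarith [hle y i₀]

/-- The subdifferential is unchanged by a step `d` orthogonal to it, provided `f` takes the same
finite value at `x`, `x + d` and `x + 2d`. -/
theorem subdiff_eq_of_eq {n : ℕ} {f : (Fin n → ℝ) → EReal} {x d : Fin n → ℝ} {c : ℝ}
    (hx : f x = c) (h1 : f (x + d) = c) (h2 : f (x + d + d) = c)
    (hd : d ∈ orthogonalTo (Submodule.span ℝ (subdiff f x))) :
    subdiff f (x + d) = subdiff f x := by
  have key : ∀ u, u ⬝ᵥ d = 0 → (u ∈ subdiff f (x + d) ↔ u ∈ subdiff f x) := by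
    intro u hu
    refine forall_congr' fun y => ?_
    have : u ⬝ᵥ (y - (x + d)) = u ⬝ᵥ (y - x) := by
      simp only [dotProduct_sub, dotProduct_add, hu, add_zero]
    change f (x + d) + ((u ⬝ᵥ (y - (x + d)) : ℝ) : EReal) ≤ _ ↔
      f x + ((u ⬝ᵥ (y - x) : ℝ) : EReal) ≤ _
    rw [this, hx, h1]
  ext u
  refine ⟨fun hu => (key u ?_).1 hu, fun hu => (key u ?_).2 hu⟩
  · have hu' : ∀ y, f (x + d) + ((u ⬝ᵥ (y - (x + d)) : ℝ) : EReal) ≤ f y := hu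
    have e1 := hu' x
    have e2 := hu' (x + d + d)
    rw [h1, hx, ← EReal.coe_add, EReal.coe_le_coe_iff, dotProduct_sub, dotProduct_add] at e1
    rw [h1, h2, ← EReal.coe_add, EReal.coe_le_coe_iff, add_sub_cancel_left] at e2
    linarith
  · exact mem_orthogonalTo.1 hd u (Submodule.subset_span hu)

/-- A ball around `x` in an affine subspace through `x` has the dimension of its direction. -/
theorem finrank_le_setDim_inter_ball {n : ℕ} (W : Submodule ℝ (Fin n → ℝ)) (x : Fin n → ℝ)
    {ε : ℝ} (hε : 0 < ε) :
    Module.finrank ℝ W ≤ setDim ((AffineSubspace.mk' x W : Set (Fin n → ℝ)) ∩ Metric.ball x ε) := by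
  refine Submodule.finrank_mono fun d hd => ?_
  have hpos : 0 < ‖d‖ + 1 := by positivity
  set t : ℝ := ε / (‖d‖ + 1) with ht
  have htpos : 0 < t := by positivity
  have htd : t • d ∈ Submodule.span ℝ {e : Fin n → ℝ |
      ∃ s ∈ (AffineSubspace.mk' x W : Set (Fin n → ℝ)) ∩ Metric.ball x ε,
      ∃ s' ∈ (AffineSubspace.mk' x W : Set (Fin n → ℝ)) ∩ Metric.ball x ε, e = s - s'} := by
    refine Submodule.subset_span ⟨x + t • d, ⟨?_, ?_⟩, x, ⟨?_, Metric.mem_ball_self hε⟩, by simp⟩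
    · simpa [AffineSubspace.mem_mk'] using W.smul_mem t hd
    · rw [mem_ball_iff_norm, add_sub_cancel_left, norm_smul, Real.norm_of_nonneg htpos.le, ht,
        div_mul_eq_mul_div, div_lt_iff₀ hpos]
      nlinarith
    · simp
  exact (Submodule.smul_mem_iff _ htpos.ne').1 htd

/-- If the codimension of the span of `∂f(x)` exceeds the rank of `A` by `k > 0`,
then there is a `k`-dimensional convex set through `x`, inside the closure of the set of
constant subdifferential, on which `Ay` and `f(y)` are constant. -/
theorem exists_flat_solution_set {n m : ℕ} (f : (Fin n → ℝ) → EReal) (hf : IsCPWL f)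
    (A : Matrix (Fin m) (Fin n) ℝ) (x : Fin n → ℝ) (hx : f x < ⊤) (k : ℕ)
    (hk : k = n - Module.finrank ℝ (Submodule.span ℝ (subdiff f x)) - A.rank)
    (hkpos : 0 < k) :
    ∃ S : Set (Fin n → ℝ), Convex ℝ S ∧ x ∈ S ∧
      S ⊆ closure {z : Fin n → ℝ | subdiff f z = subdiff f x} ∧
      k ≤ setDim S ∧
      ∀ y ∈ S, A.mulVec y = A.mulVec x ∧ f y = f x := by
  obtain ⟨⟨c, hc⟩, ε, hε, hconst⟩ := hf.exists_forall_eq_of_mem_orthogonalTo hx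
  set V := orthogonalTo (Submodule.span ℝ (subdiff f x)) with hV
  refine ⟨(AffineSubspace.mk' x (V ⊓ LinearMap.ker A.mulVecLin) : Set (Fin n → ℝ)) ∩
    Metric.ball x (ε / 2), (AffineSubspace.convex _).inter (convex_ball _ _),
    ⟨by simp, Metric.mem_ball_self (half_pos hε)⟩, ?_, ?_, ?_⟩
  · rintro y ⟨hyW, hyb⟩
    obtain ⟨hyV, -⟩ : y - x ∈ V ∧ _ := (AffineSubspace.mem_mk').1 hyW
    obtain ⟨d, rfl⟩ : ∃ d, y = x + d := ⟨y - x, by simp⟩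
    rw [mem_ball_iff_norm] at hyb
    rw [add_sub_cancel_left] at hyV hyb
    refine subset_closure (subdiff_eq_of_eq hc ?_ ?_ hyV)
    · rw [← hc]
      refine hconst _ ?_ (by simpa using hyV)
      rw [mem_ball_iff_norm, add_sub_cancel_left]
      linarith
    · rw [← hc]
      have e : x + d + d - x = d + d := by abel
      refine hconst _ ?_ (e ▸ V.add_mem hyV hyV)
      rw [mem_ball_iff_norm, e]
      linarith [norm_add_le d d]
  · rw [hk]
    exact (le_finrank_orthogonalTo_inf_ker _ A).trans
      (finrank_le_setDim_inter_ball _ x (half_pos hε))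
  · rintro y ⟨hyW, hyb⟩
    obtain ⟨hyV, hyA⟩ : y - x ∈ V ∧ y - x ∈ LinearMap.ker A.mulVecLin :=
      (AffineSubspace.mem_mk').1 hyW
    refine ⟨?_, hconst y (Metric.ball_subset_ball (half_le_self hε.le) hyb) hyV⟩
    rw [LinearMap.mem_ker, Matrix.mulVecLin_apply, Matrix.mulVec_sub] at hyA
    exact sub_eq_zero.1 hyA

end
end

section
/- Let f : ℝ^n → ℝ ∪ {+∞} be convex piecewise linear such that the affine hull of dom(f) = {x | f(x) < +∞} is all of ℝ^n, and let A ∈ ℝ^{m×n}. Suppose there exist distinct x, y ∈ ℝ^n with Ax = Ay and row(A) ∩ ∂f(x) ∩ ∂f(y) ≠ ∅. Then there exists z ∈ ℝ^n with f(z) < +∞ such that both x and y lie in the closure of {w ∈ ℝ^n | ∂f(w) = ∂f(z)} and n − dim(∂f(z)) > rank(A). -/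
noncomputable section

open Matrix Topology

theorem IsPolyhedron.isClosed {n : ℕ} {P : Set (Fin n → ℝ)} (hP : IsPolyhedron P) :
    IsClosed P := by
  obtain ⟨k, a, β, rfl⟩ := hP
  simp only [Set.ofPred_forall]
  exact isClosed_iInter fun i => isClosed_le (by fun_prop) continuous_const

theorem IsPolyhedron.convex {n : ℕ} {P : Set (Fin n → ℝ)} (hP : IsPolyhedron P) :
    Convex ℝ P := by
  obtain ⟨k, a, β, rfl⟩ := hP
  simp only [Set.ofPred_forall]
  exact convex_iInter fun i =>
    convex_halfSpace_le ⟨fun x y => dotProduct_add (a i) x y, fun c x => dotProduct_smul c (a i) x⟩ _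

/-- The part of `P` on which the `i`-th of the affine functions `v j ⬝ᵥ x + w j` is maximal. -/
def maxCell {n : ℕ} {ι : Type*} (P : Set (Fin n → ℝ)) (v : ι → Fin n → ℝ) (w : ι → ℝ) (i : ι) :
    Set (Fin n → ℝ) :=
  P ∩ {x | ∀ j, v j ⬝ᵥ x + w j ≤ v i ⬝ᵥ x + w i}

theorem maxCell_isClosed {n : ℕ} {ι : Type*} {P : Set (Fin n → ℝ)} (hP : IsClosed P)
    (v : ι → Fin n → ℝ) (w : ι → ℝ) (i : ι) : IsClosed (maxCell P v w i) := by
  refine hP.inter ?_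
  simp only [Set.ofPred_forall, dotProduct]
  exact isClosed_iInter fun j => isClosed_le (by fun_prop) (by fun_prop)

theorem maxCell_convex {n : ℕ} {ι : Type*} {P : Set (Fin n → ℝ)} (hP : Convex ℝ P)
    (v : ι → Fin n → ℝ) (w : ι → ℝ) (i : ι) : Convex ℝ (maxCell P v w i) := by
  refine hP.inter fun x hx y hy s t hs ht hst j => ?_
  have h₁ := mul_le_mul_of_nonneg_left (hx j) hs
  have h₂ := mul_le_mul_of_nonneg_left (hy j) ht
  simp only [dotProduct_add, dotProduct_smul, smul_eq_mul]
  have hj : w j = s * w j + t * w j := by rw [← add_mul, hst, one_mul]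
  have hi : w i = s * w i + t * w i := by rw [← add_mul, hst, one_mul]
  linarith

/-- If finitely many closed sets cover a set `S`, then every point of the closure of the interior
of `S` lies in the closure of the interior of one of them. -/
theorem exists_mem_closure_interior_of_subset_iUnion {X ι : Type*} [TopologicalSpace X]
    [BaireSpace X] [Finite ι] {S : Set X} {D : ι → Set X} (hD : ∀ i, IsClosed (D i))
    (hS : S ⊆ ⋃ i, D i) {x : X} (hx : x ∈ closure (interior S)) :
    ∃ i, x ∈ closure (interior (D i)) := by
  by_contra! h
  have hU : IsOpen (⋂ i, (closure (interior (D i)))ᶜ) :=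
    isOpen_iInter_of_finite fun i => isClosed_closure.isOpen_compl
  have hne := mem_closure_iff.1 hx _ hU (Set.mem_iInter.2 h)
  have hdense : Dense (⋂ i, (frontier (D i))ᶜ) :=
    dense_iInter_of_isOpen (fun i => isClosed_frontier.isOpen_compl) fun i =>
      interior_eq_empty_iff_dense_compl.1 (interior_frontier (hD i))
  obtain ⟨p, ⟨hpU, hpS⟩, hpF⟩ := hdense.inter_open_nonempty _ (hU.inter isOpen_interior) hne
  obtain ⟨i, hi⟩ := Set.mem_iUnion.1 (hS (interior_subset hpS))
  refine Set.mem_iInter.1 hpU i (subset_closure ?_)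
  by_contra hpi
  exact Set.mem_iInter.1 hpF i ((hD i).frontier_eq ▸ ⟨hi, hpi⟩)

/-- A function that is affine near `p`, and minorized by the same affine function everywhere, has
a singleton subdifferential at `p`. -/
theorem subdiff_eq_singleton {n : ℕ} {f : (Fin n → ℝ) → EReal} {p v : Fin n → ℝ} {c : ℝ}
    (hloc : ∀ᶠ q in 𝓝 p, f q = ((v ⬝ᵥ q + c : ℝ) : EReal))
    (hmin : ∀ q, ((v ⬝ᵥ q + c : ℝ) : EReal) ≤ f q) : subdiff f p = {v} := by
  have hp := hloc.self_of_nhds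
  ext u
  rw [Set.mem_singleton_iff]
  change (∀ q, f p + ((u ⬝ᵥ (q - p) : ℝ) : EReal) ≤ f q) ↔ _
  rw [hp]
  refine ⟨fun hu => ?_, ?_⟩
  · have ht : Filter.Tendsto (fun t : ℝ => p + t • (u - v)) (𝓝[>] 0) (𝓝 p) := by
      refine Filter.Tendsto.mono_left ?_ nhdsWithin_le_nhds
      have : Continuous fun t : ℝ => p + t • (u - v) := by fun_prop
      simpa using this.tendsto 0
    obtain ⟨t, hft, ht0⟩ := ((ht.eventually hloc).and self_mem_nhdsWithin).exists
    have h := hu (p + t • (u - v))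
    rw [hft, ← EReal.coe_add, EReal.coe_le_coe_iff] at h
    have hle : t * ((u - v) ⬝ᵥ (u - v)) ≤ 0 := by
      rw [sub_dotProduct u v (u - v)]
      simp only [add_sub_cancel_left, dotProduct_add, dotProduct_smul, smul_eq_mul] at h
      linarith
    have hsq : (u - v) ⬝ᵥ (u - v) = 0 :=
      le_antisymm (nonpos_of_mul_nonpos_right hle ht0)
        (Finset.sum_nonneg fun i _ => mul_self_nonneg _)
    exact sub_eq_zero.1 (dotProduct_self_eq_zero.1 hsq)
  · rintro rfl q
    refine le_trans (le_of_eq ?_) (hmin q)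
    rw [← EReal.coe_add, dotProduct_sub]
    congr 1
    ring

theorem setDim_singleton {n : ℕ} (v : Fin n → ℝ) : setDim {v} = 0 := by
  simp [setDim]

theorem lt_top_of_subdiff_nonempty {n : ℕ} {f : (Fin n → ℝ) → EReal} {x : Fin n → ℝ}
    (hdom : ∃ p, f p < ⊤) (hx : (subdiff f x).Nonempty) : f x < ⊤ := by
  obtain ⟨p, hp⟩ := hdom
  obtain ⟨u, hu⟩ := hx
  refine lt_top_iff_ne_top.2 fun h => hp.ne (top_le_iff.1 ?_)
  simpa [h] using hu p

theorem rank_lt_of_mulVec_eq {m n : ℕ} {A : Matrix (Fin m) (Fin n) ℝ} {x y : Fin n → ℝ}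
    (hxy : x ≠ y) (h : A.mulVec x = A.mulVec y) : A.rank < n := by
  have hker : 0 < Module.finrank ℝ (LinearMap.ker A.mulVecLin) := by
    rw [Module.finrank_pos_iff_exists_ne_zero]
    refine ⟨⟨x - y, ?_⟩, fun h0 => hxy (sub_eq_zero.1 (congrArg Subtype.val h0))⟩
    simp [mulVec_sub, h]
  have hrn := A.mulVecLin.finrank_range_add_finrank_ker
  rw [Module.finrank_fin_fun] at hrn
  rw [Matrix.rank]
  omega

/-- Two distinct points with equal image under `A` and a common subgradient in the row
space of `A` force a set of constant subdifferential of large codimension. -/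
theorem two_solutions_large_codimension {n m : ℕ} (f : (Fin n → ℝ) → EReal)
    (hf : IsCPWL f) (hdom : affineSpan ℝ {x : Fin n → ℝ | f x < ⊤} = ⊤)
    (A : Matrix (Fin m) (Fin n) ℝ) (x y : Fin n → ℝ) (hxy : x ≠ y)
    (hAxy : A.mulVec x = A.mulVec y)
    (hrow : (rowSpace A ∩ subdiff f x ∩ subdiff f y).Nonempty) :
    ∃ z : Fin n → ℝ, f z < ⊤ ∧
      x ∈ closure {w : Fin n → ℝ | subdiff f w = subdiff f z} ∧
      y ∈ closure {w : Fin n → ℝ | subdiff f w = subdiff f z} ∧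
      A.rank < n - setDim (subdiff f z) := by
  obtain ⟨k, v, w, P, hP, hfP, hftop⟩ := hf
  have hPdom : {x | f x < ⊤} = P := by
    ext p
    by_cases hp : p ∈ P
    · simp only [Set.mem_ofPred_eq, hfP p hp, hp, EReal.coe_lt_top]
    · simp [hp, hftop p hp]
  have hdomP (p) : f p < ⊤ ↔ p ∈ P := Set.ext_iff.1 hPdom p
  rw [hPdom] at hdom
  have hPint : (interior P).Nonempty := hP.convex.interior_nonempty_iff_affineSpan_eq_top.2 hdom
  have hne : ∃ p, f p < ⊤ := (hPint.mono interior_subset).imp fun p => (hdomP p).2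
  have hminor (i p) : ((v i ⬝ᵥ p + w i : ℝ) : EReal) ≤ f p := by
    by_cases hp : p ∈ P
    · rw [hfP p hp, EReal.coe_le_coe_iff]
      exact Finset.le_sup' (fun i => ∑ j, v i j * p j + w i) (Finset.mem_univ i)
    · simp [hftop p hp]
  have hcell (i p) (hp : p ∈ maxCell P v w i) : f p = ((v i ⬝ᵥ p + w i : ℝ) : EReal) := by
    refine le_antisymm ?_ (hminor i p)
    rw [hfP p hp.1, EReal.coe_le_coe_iff]
    exact Finset.sup'_le _ _ fun j _ => hp.2 j
  have hmem (i p) (hp : f p = ((v i ⬝ᵥ p + w i : ℝ) : EReal)) : p ∈ maxCell P v w i := by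
    refine ⟨(hdomP p).1 (hp ▸ EReal.coe_lt_top _), fun j => ?_⟩
    rw [← EReal.coe_le_coe_iff, ← hp]
    exact hminor j p
  have hcover : P ⊆ ⋃ i, maxCell P v w i := fun p hp => by
    obtain ⟨i, -, hi⟩ := Finset.exists_mem_eq_sup' (Finset.univ_nonempty (α := Fin (k + 1)))
      fun i => ∑ j, v i j * p j + w i
    exact Set.mem_iUnion.2 ⟨i, hmem i p (by rw [hfP p hp, hi]; rfl)⟩
  obtain ⟨u, ⟨⟨s, rfl⟩, hux⟩, huy⟩ := hrow
  have hxP := (hdomP x).1 (lt_top_of_subdiff_nonempty hne ⟨_, hux⟩)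
  have hyP := (hdomP y).1 (lt_top_of_subdiff_nonempty hne ⟨_, huy⟩)
  have hzP : midpoint ℝ x y ∈ P := hP.convex.midpoint_mem hxP hyP
  have hfx (q) (hq : A *ᵥ q = A *ᵥ x) : f x ≤ f q := by
    have h : f x + ((s ᵥ* A ⬝ᵥ (q - x) : ℝ) : EReal) ≤ f q := hux q
    simpa [← dotProduct_mulVec, mulVec_sub, hq] using h
  have hfy (q) (hq : A *ᵥ q = A *ᵥ y) : f y ≤ f q := by
    have h : f y + ((s ᵥ* A ⬝ᵥ (q - y) : ℝ) : EReal) ≤ f q := huy q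
    simpa [← dotProduct_mulVec, mulVec_sub, hq] using h
  have hAz : A *ᵥ midpoint ℝ x y = A *ᵥ x := by
    rw [midpoint_eq_smul_add, mulVec_smul, mulVec_add, ← hAxy, ← two_smul ℝ, invOf_smul_smul]
  obtain ⟨i, hi⟩ := exists_mem_closure_interior_of_subset_iUnion
    (fun i => maxCell_isClosed hP.isClosed v w i) hcover
    (x := midpoint ℝ x y)
    (hP.convex.closure_interior_eq_closure_of_nonempty_interior hPint ▸ subset_closure hzP)
  have hfz := hcell i _
    ((maxCell_isClosed hP.isClosed v w i).closure_subset_iff.2 interior_subset hi)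
  have hlx := (hminor i x).trans (hfx _ hAz)
  have hly := (hminor i y).trans (hfy _ (hAz.trans hAxy))
  have hzmid : v i ⬝ᵥ midpoint ℝ x y = (v i ⬝ᵥ x + v i ⬝ᵥ y) / 2 := by
    rw [midpoint_eq_smul_add, dotProduct_smul, dotProduct_add, invOf_eq_inv, smul_eq_mul]
    ring
  have hxle := hfx _ hAz
  have hyle := hfy _ (hAz.trans hAxy)
  rw [hfz, EReal.coe_le_coe_iff, hzmid] at hlx hly
  rw [hfz, hzmid] at hxle hyle
  have hx : x ∈ maxCell P v w i := hmem i x <| le_antisymm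
    (hxle.trans (EReal.coe_le_coe_iff.2 (by linarith))) (hminor i x)
  have hy : y ∈ maxCell P v w i := hmem i y <| le_antisymm
    (hyle.trans (EReal.coe_le_coe_iff.2 (by linarith))) (hminor i y)
  have hint : (interior (maxCell P v w i)).Nonempty := closure_nonempty_iff.1 ⟨_, hi⟩
  have hsub (p) (hp : p ∈ interior (maxCell P v w i)) : subdiff f p = {v i} :=
    subdiff_eq_singleton
      (Filter.mem_of_superset (mem_interior_iff_mem_nhds.1 hp) (hcell i)) (hminor i)
  obtain ⟨z, hz⟩ := hint
  have hclosure : maxCell P v w i ⊆ closure {p | subdiff f p = subdiff f z} := by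
    refine subset_closure.trans ?_
    rw [← (maxCell_convex hP.convex v w i).closure_interior_eq_closure_of_nonempty_interior ⟨z, hz⟩]
    exact closure_mono fun p hp => (hsub p hp).trans (hsub z hz).symm
  refine ⟨z, (hdomP z).2 (interior_subset hz).1, hclosure hx, hclosure hy, ?_⟩
  rw [hsub z hz, setDim_singleton, Nat.sub_zero]
  exact rank_lt_of_mulVec_eq hxy hAxy

end
end

section
/- Let f : ℝ^n → ℝ ∪ {+∞} be proper (finite at some point), convex (f(tx + (1−t)y) ≤ t f(x) + (1−t) f(y) for all x, y and t ∈ [0,1], in ℝ ∪ {+∞}), and lower semicontinuous; let D be a smooth data fidelity function and A ∈ ℝ^{m×n}. Then for x ∈ ℝ^n the following are equivalent: (1) there exists b ∈ ℝ^m with x ∈ S(b); (2) row(A) ∩ ∂f(x) ≠ ∅. -/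
noncomputable section

/-- A function lying above a line of slope `K` through its value at `0`, on `(0, 1]`, has
derivative at least `K` at `0`. -/
theorem le_of_hasDerivAt_zero_of_line_le {φ : ℝ → ℝ} {K L : ℝ} (h : HasDerivAt φ L 0)
    (hK : ∀ t, 0 < t → t ≤ 1 → φ 0 + t * K ≤ φ t) : K ≤ L := by
  refine ge_of_tendsto h.tendsto_slope_zero_right ?_
  filter_upwards [Ioc_mem_nhdsGT (zero_lt_one' ℝ)] with t ht
  have h1 := hK t ht.1 ht.2
  rw [zero_add, smul_eq_mul, ← div_eq_inv_mul, le_div_iff₀ ht.1]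
  linarith

/-- Derivative of a differentiable function along a line. -/
theorem Differentiable.hasDerivAt_add_smul {E : Type*} [NormedAddCommGroup E] [NormedSpace ℝ E]
    {F : E → ℝ} (hF : Differentiable ℝ F) (z w : E) :
    HasDerivAt (fun t : ℝ => F (z + t • w)) (fderiv ℝ F z w) 0 := by
  have h1 : HasDerivAt (fun t : ℝ => z + t • w) w 0 := by
    simpa using ((hasDerivAt_id (0 : ℝ)).smul_const w).const_add z
  have h2 : HasFDerivAt F (fderiv ℝ F z) (z + (0 : ℝ) • w) := by
    simpa using (hF z).hasFDerivAt
  exact h2.comp_hasDerivAt (0 : ℝ) h1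

/-- The gradient inequality for differentiable convex functions. -/
theorem ConvexOn.add_fderiv_sub_le {E : Type*} [NormedAddCommGroup E] [NormedSpace ℝ E]
    {F : E → ℝ} (hc : ConvexOn ℝ Set.univ F) (hF : Differentiable ℝ F) (z z' : E) :
    F z + fderiv ℝ F z (z' - z) ≤ F z' := by
  have key := le_of_hasDerivAt_zero_of_line_le (K := -(F z' - F z))
    (hF.hasDerivAt_add_smul z (z' - z)).neg fun t ht ht1 => by
      have h := hc.2 (Set.mem_univ z) (Set.mem_univ z') (sub_nonneg.2 ht1) ht.le
        (sub_add_cancel 1 t)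
      have e : (1 - t) • z + t • z' = z + t • (z' - z) := by module
      rw [e] at h
      simp only [smul_eq_mul, Pi.neg_apply, zero_smul, add_zero] at h ⊢
      linarith
  linarith

/-- The adjoint identity for the pairing of a row combination with a difference. -/
theorem sum_vecMul_mul_sub {m n : ℕ} (A : Matrix (Fin m) (Fin n) ℝ) (z : Fin m → ℝ)
    (x y : Fin n → ℝ) :
    ∑ j, Matrix.vecMul z A j * (y j - x j) = ∑ i, z i * (A.mulVec y - A.mulVec x) i := by
  rw [← Matrix.mulVec_sub]
  exact (Matrix.dotProduct_mulVec z A (y - x)).symm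

/-- Range condition for general regularization: `x` is a solution for some data `b`
if and only if the row space of `A` meets `∂f(x)`. -/
theorem range_condition {n m : ℕ} (f : (Fin n → ℝ) → EReal)
    (hproper : ∃ x, f x < ⊤) (hbot : ∀ x, f x ≠ ⊥)
    (hconv : ∀ x y : Fin n → ℝ, ∀ t : ℝ, 0 ≤ t → t ≤ 1 →
      f (t • x + (1 - t) • y) ≤ (t : EReal) * f x + ((1 - t : ℝ) : EReal) * f y)
    (hlsc : LowerSemicontinuous f)
    (D : (Fin m → ℝ) → (Fin m → ℝ) → ℝ) (g : (Fin m → ℝ) → (Fin m → ℝ) → (Fin m → ℝ))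
    (hD : IsSmoothDataFidelity D g) (A : Matrix (Fin m) (Fin n) ℝ) (x : Fin n → ℝ) :
    (∃ b : Fin m → ℝ, x ∈ solSet D A f b) ↔ (rowSpace A ∩ subdiff f x).Nonempty := by
  obtain ⟨hsc, hdiff, hgrad, hbij⟩ := hD
  obtain ⟨x₀, hx₀⟩ := hproper
  constructor
  · rintro ⟨b, hb⟩
    have hx : f x ≠ ⊤ := by
      intro h
      have h1 := hb x₀
      rw [h, EReal.coe_add_top, top_le_iff] at h1
      exact (EReal.add_lt_top (EReal.coe_ne_top _) hx₀.ne).ne h1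
    refine ⟨Matrix.vecMul (-g (A.mulVec x) b) A, ⟨_, rfl⟩, fun y => ?_⟩
    by_cases hy : f y = ⊤
    · rw [hy]; exact le_top
    lift f x to ℝ using ⟨hx, hbot x⟩ with a ha
    lift f y to ℝ using ⟨hy, hbot y⟩ with c hc
    rw [sum_vecMul_mul_sub]
    have key := le_of_hasDerivAt_zero_of_line_le (K := -(c - a))
      ((hdiff b).hasDerivAt_add_smul (A.mulVec x) (A.mulVec y - A.mulVec x))
      fun t ht ht1 => by
        have h1 := hb (t • y + (1 - t) • x)
        have h2 := hconv y x t ht.le ht1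
        have e : A.mulVec (t • y + (1 - t) • x)
            = A.mulVec x + t • (A.mulVec y - A.mulVec x) := by
          rw [Matrix.mulVec_add, Matrix.mulVec_smul, Matrix.mulVec_smul]
          module
        rw [e, ← ha] at h1
        rw [← ha, ← hc] at h2
        have h3 := h1.trans (add_le_add_right h2 _)
        norm_cast at h3
        simp only [zero_smul, add_zero]
        linarith
    rw [hgrad] at key
    norm_cast
    simp only [Pi.neg_apply, neg_mul, Finset.sum_neg_distrib]
    linarith
  · rintro ⟨v, ⟨z, rfl⟩, hv⟩
    have hx : f x ≠ ⊤ := by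
      intro h
      have h1 := hv x₀
      rw [h, EReal.top_add_coe, top_le_iff] at h1
      exact hx₀.ne h1
    obtain ⟨b, hb⟩ := (hbij (A.mulVec x)).2 (-z)
    refine ⟨b, fun y => ?_⟩
    by_cases hy : f y = ⊤
    · rw [hy, EReal.coe_add_top]; exact le_top
    have h1 := hv y
    rw [sum_vecMul_mul_sub] at h1
    lift f x to ℝ using ⟨hx, hbot x⟩ with a ha
    lift f y to ℝ using ⟨hy, hbot y⟩ with c hc
    have h2 := (hsc b).convexOn.add_fderiv_sub_le (hdiff b) (A.mulVec x) (A.mulVec y)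
    have hb' : g (A.mulVec x) b = -z := hb
    rw [hgrad, hb'] at h2
    simp only [Pi.neg_apply, neg_mul, Finset.sum_neg_distrib] at h2
    norm_cast at h1 ⊢
    linarith

end
end

section
/- Let f : ℝ^n → ℝ ∪ {+∞} be convex piecewise linear, let D be a smooth data fidelity function, let A ∈ ℝ^{m×n}, and let z ∈ ℝ^n with f(z) < +∞. Then the closure of {w ∈ ℝ^n | ∂f(w) = ∂f(z)} is contained in the range of the solution map, {x | ∃ b ∈ ℝ^m, x ∈ S(b)}, if and only if row(A) ∩ ∂f(z) ≠ ∅. -/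
noncomputable section

/-- A convex piecewise linear function is a continuous real function, convex on a closed set,
extended by `⊤`. -/
lemma IsCPWL.exists_convexOn {n : ℕ} {f : (Fin n → ℝ) → EReal} (hf : IsCPWL f) :
    ∃ (P : Set (Fin n → ℝ)) (F : (Fin n → ℝ) → ℝ), IsClosed P ∧ Continuous F ∧
      ConvexOn ℝ P F ∧ (∀ x ∈ P, f x = (F x : EReal)) ∧ ∀ x ∉ P, f x = ⊤ := by
  obtain ⟨k, v, w, P, ⟨l, a, β, rfl⟩, hfP, hfT⟩ := hf
  refine ⟨_, _, ?_, ?_, ⟨?_, ?_⟩, hfP, hfT⟩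
  · simp only [Set.ofPred_forall]
    exact isClosed_iInter fun i => isClosed_le (by fun_prop) continuous_const
  · exact Continuous.finset_sup'_apply _ fun i _ => by fun_prop
  · intro x hx y hy s t hs ht hst i
    have h : ∑ j, a i j * (s • x + t • y) j
        = s * ∑ j, a i j * x j + t * ∑ j, a i j * y j := by
      simp only [Finset.mul_sum, ← Finset.sum_add_distrib, Pi.add_apply, Pi.smul_apply,
        smul_eq_mul]
      exact Finset.sum_congr rfl fun j _ => by ring
    rw [h]
    calc _ ≤ s * β i + t * β i := by gcongr; exacts [hx i, hy i]
      _ = β i := by rw [← add_mul, hst, one_mul]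
  · intro x _ y _ s t hs ht hst
    refine Finset.sup'_le _ _ fun i hi => ?_
    have h : ∑ j, v i j * (s • x + t • y) j + w i
        = s * (∑ j, v i j * x j + w i) + t * (∑ j, v i j * y j + w i) := by
      have hw : w i = s * w i + t * w i := by rw [← add_mul, hst, one_mul]
      have hsum : ∑ j, v i j * (s • x + t • y) j
          = s * ∑ j, v i j * x j + t * ∑ j, v i j * y j := by
        simp only [Finset.mul_sum, ← Finset.sum_add_distrib, Pi.add_apply, Pi.smul_apply,
          smul_eq_mul]
        exact Finset.sum_congr rfl fun j _ => by ring
      rw [hsum]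
      linarith
    rw [h, smul_eq_mul, smul_eq_mul]
    gcongr
    · exact Finset.le_sup' (fun i => ∑ j, v i j * x j + w i) hi
    · exact Finset.le_sup' (fun i => ∑ j, v i j * y j + w i) hi

lemma mem_subdiff_iff {n : ℕ} {f : (Fin n → ℝ) → EReal} {P : Set (Fin n → ℝ)}
    {F : (Fin n → ℝ) → ℝ} (hfP : ∀ x ∈ P, f x = (F x : EReal)) (hfT : ∀ x ∉ P, f x = ⊤)
    {x : Fin n → ℝ} (hx : x ∈ P) {v : Fin n → ℝ} :
    v ∈ subdiff f x ↔ ∀ y ∈ P, F x + v ⬝ᵥ (y - x) ≤ F y := by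
  refine ⟨fun h y hy => ?_, fun h y => ?_⟩
  · have := h y
    rw [hfP x hx, hfP y hy] at this
    exact_mod_cast this
  · by_cases hy : y ∈ P
    · rw [hfP x hx, hfP y hy]
      exact_mod_cast h y hy
    · simp [hfT y hy]

lemma mem_solSet_iff {m n : ℕ} {f : (Fin n → ℝ) → EReal} {P : Set (Fin n → ℝ)}
    {F : (Fin n → ℝ) → ℝ} (hfP : ∀ x ∈ P, f x = (F x : EReal)) (hfT : ∀ x ∉ P, f x = ⊤)
    (D : (Fin m → ℝ) → (Fin m → ℝ) → ℝ) (A : Matrix (Fin m) (Fin n) ℝ) (b : Fin m → ℝ)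
    {x : Fin n → ℝ} (hx : x ∈ P) :
    x ∈ solSet D A f b ↔ ∀ y ∈ P, D (A.mulVec x) b + F x ≤ D (A.mulVec y) b + F y := by
  refine ⟨fun h y hy => ?_, fun h y => ?_⟩
  · have := h y
    rw [hfP x hx, hfP y hy] at this
    exact_mod_cast this
  · by_cases hy : y ∈ P
    · rw [hfP x hx, hfP y hy]
      exact_mod_cast h y hy
    · simp [hfT y hy]

lemma hasDerivAt_lineMap_comp {E : Type*} [NormedAddCommGroup E] [NormedSpace ℝ E] {φ : E → ℝ}
    {x : E} (hφ : DifferentiableAt ℝ φ x) (d : E) :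
    HasDerivAt (fun t : ℝ => φ (x + t • d)) (fderiv ℝ φ x d) 0 := by
  have h : HasDerivAt (fun t : ℝ => x + t • d) d 0 := by
    simpa using ((hasDerivAt_id (0 : ℝ)).smul_const d).const_add x
  have h' : HasFDerivAt φ (fderiv ℝ φ x) (x + (0 : ℝ) • d) := by simpa using hφ.hasFDerivAt
  exact h'.comp_hasDerivAt 0 h

lemma ConvexOn.add_fderiv_le {E : Type*} [NormedAddCommGroup E] [NormedSpace ℝ E] {φ : E → ℝ}
    (hc : ConvexOn ℝ Set.univ φ) {x : E} (hφ : DifferentiableAt ℝ φ x) (d : E) :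
    φ x + fderiv ℝ φ x d ≤ φ (x + d) := by
  have hc' : ConvexOn ℝ Set.univ fun t : ℝ => φ (x + t • d) := by
    refine ⟨convex_univ, fun s _ t _ p q hp hq hpq => ?_⟩
    have h := hc.2 (Set.mem_univ (x + s • d)) (Set.mem_univ (x + t • d)) hp hq hpq
    convert h using 2
    have hx : p • x + q • x = x := by rw [← add_smul, hpq, one_smul]
    nth_rewrite 1 [← hx]
    simp only [smul_eq_mul]
    module
  have h := hc'.le_slope_of_hasDerivAt (Set.mem_univ 0) (Set.mem_univ 1) one_pos
    (hasDerivAt_lineMap_comp hφ d)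
  simp [slope_def_field] at h
  linarith

/-- First order optimality condition for the sum of a smooth and a convex function. -/
lemma ConvexOn.le_of_forall_add_le {E E' : Type*} [NormedAddCommGroup E] [NormedSpace ℝ E]
    [AddCommGroup E'] [Module ℝ E'] (L : E' →ₗ[ℝ] E) {φ : E → ℝ} {P : Set E'} {F : E' → ℝ}
    (hF : ConvexOn ℝ P F) {x : E'} (hx : x ∈ P) (hφ : DifferentiableAt ℝ φ (L x))
    (hmin : ∀ y ∈ P, φ (L x) + F x ≤ φ (L y) + F y) {y : E'} (hy : y ∈ P) :
    F x - fderiv ℝ φ (L x) (L (y - x)) ≤ F y := by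
  have h := (hasDerivAt_lineMap_comp hφ (L (y - x))).tendsto_slope_zero_right
  simp only [zero_add, zero_smul, add_zero, smul_eq_mul] at h
  have key : F x - F y ≤ fderiv ℝ φ (L x) (L (y - x)) := by
    refine ge_of_tendsto h ?_
    filter_upwards [Ioo_mem_nhdsGT (zero_lt_one' ℝ)] with t ht
    have hs : (1 - t) • x + t • y = x + t • (y - x) := by module
    have h1 := hF.2 hx hy (sub_nonneg.2 ht.2.le) ht.1.le (by ring)
    have h2 := hmin _ (hF.1 hx hy (sub_nonneg.2 ht.2.le) ht.1.le (by ring))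
    rw [hs] at h1 h2
    simp only [map_add, map_smul, smul_eq_mul] at h1 h2
    rw [inv_mul_eq_div, le_div_iff₀ ht.1]
    linarith
  linarith

/-- A point of the domain is a solution for some data iff the row space of `A` meets the
subdifferential there. -/
lemma exists_mem_solSet_iff {m n : ℕ} {f : (Fin n → ℝ) → EReal} {P : Set (Fin n → ℝ)}
    {F : (Fin n → ℝ) → ℝ} (hF : ConvexOn ℝ P F) (hfP : ∀ x ∈ P, f x = (F x : EReal))
    (hfT : ∀ x ∉ P, f x = ⊤) {D : (Fin m → ℝ) → (Fin m → ℝ) → ℝ}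
    {g : (Fin m → ℝ) → (Fin m → ℝ) → (Fin m → ℝ)} (hD : IsSmoothDataFidelity D g)
    (A : Matrix (Fin m) (Fin n) ℝ) {x : Fin n → ℝ} (hx : x ∈ P) :
    (∃ b, x ∈ solSet D A f b) ↔ (rowSpace A ∩ subdiff f x).Nonempty := by
  obtain ⟨hconv, hdiff, hgrad, hbij⟩ := hD
  have hgrad' (b) (v) : fderiv ℝ (fun z => D z b) (A.mulVec x) (A.mulVec v)
      = Matrix.vecMul (g (A.mulVec x) b) A ⬝ᵥ v := by
    rw [hgrad, ← Matrix.dotProduct_mulVec]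
    rfl
  constructor
  · rintro ⟨b, hb⟩
    rw [mem_solSet_iff hfP hfT D A b hx] at hb
    refine ⟨_, ⟨-g (A.mulVec x) b, rfl⟩, (mem_subdiff_iff hfP hfT hx).2 fun y hy => ?_⟩
    have h := hF.le_of_forall_add_le A.mulVecLin hx (hdiff b _) hb hy
    simp only [Matrix.mulVecLin_apply, hgrad'] at h
    rwa [Matrix.neg_vecMul, neg_dotProduct, ← sub_eq_add_neg]
  · rintro ⟨_, ⟨u, rfl⟩, hu⟩
    obtain ⟨b, hb⟩ := (hbij (A.mulVec x)).2 (-u)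
    refine ⟨b, (mem_solSet_iff hfP hfT D A b hx).2 fun y hy => ?_⟩
    have h1 := (mem_subdiff_iff hfP hfT hx).1 hu y hy
    have h2 := (hconv b).convexOn.add_fderiv_le (hdiff b (A.mulVec x)) (A.mulVec (y - x))
    simp only at hb
    rw [hgrad', hb, Matrix.neg_vecMul, neg_dotProduct, ← Matrix.mulVec_add,
      add_sub_cancel] at h2
    linarith

/-- Range condition for convex piecewise linear regularization: the closure of a set of
constant subdifferential lies in the range of the solution map iff the row space of `A`
meets the corresponding subdifferential. -/
theorem range_condition_piecewise_linear {n m : ℕ} (f : (Fin n → ℝ) → EReal)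
    (hf : IsCPWL f) (D : (Fin m → ℝ) → (Fin m → ℝ) → ℝ)
    (g : (Fin m → ℝ) → (Fin m → ℝ) → (Fin m → ℝ)) (hD : IsSmoothDataFidelity D g)
    (A : Matrix (Fin m) (Fin n) ℝ) (z : Fin n → ℝ) (hz : f z < ⊤) :
    closure {w : Fin n → ℝ | subdiff f w = subdiff f z} ⊆
        {x : Fin n → ℝ | ∃ b : Fin m → ℝ, x ∈ solSet D A f b} ↔
      (rowSpace A ∩ subdiff f z).Nonempty := by
  obtain ⟨P, F, hPc, hFc, hF, hfP, hfT⟩ := hf.exists_convexOn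
  have hzP : z ∈ P := by
    by_contra h
    exact hz.ne (hfT z h)
  constructor
  · intro h
    exact (exists_mem_solSet_iff hF hfP hfT hD A hzP).1 (h (subset_closure rfl))
  · rintro ⟨v, hvA, hv⟩ x hx
    have hclosed : IsClosed (P ∩ ⋂ y ∈ P, {w | F w + v ⬝ᵥ (y - w) ≤ F y}) :=
      hPc.inter <| isClosed_biInter fun y _ => isClosed_le
        (hFc.add (continuous_const.dotProduct (continuous_const.sub continuous_id)))
        continuous_const
    have hsub : {w | subdiff f w = subdiff f z} ⊆
        P ∩ ⋂ y ∈ P, {w | F w + v ⬝ᵥ (y - w) ≤ F y} := by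
      intro w hw
      have hvw : v ∈ subdiff f w := by rwa [show subdiff f w = subdiff f z from hw]
      have hwP : w ∈ P := by
        by_contra h
        have := hvw z
        rw [hfT w h, EReal.top_add_coe] at this
        exact hz.not_ge this
      exact ⟨hwP, Set.mem_iInter₂.2 ((mem_subdiff_iff hfP hfT hwP).1 hvw)⟩
    obtain ⟨hxP, hxv⟩ := closure_minimal hsub hclosed hx
    exact (exists_mem_solSet_iff hF hfP hfT hD A hxP).2
      ⟨v, hvA, (mem_subdiff_iff hfP hfT hxP).2 (Set.mem_iInter₂.1 hxv)⟩

end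
end

section
/- Let D : ℝ^m × ℝ^m → ℝ be an arbitrary function, let f : ℝ^n → ℝ ∪ {+∞} be convex piecewise linear, let A ∈ ℝ^{m×n} and b ∈ ℝ^m, and suppose x ∈ S(b) with f(x) < +∞. If k := n − dim(∂f(x)) − rank(A) > 0, then dim(S(b)) ≥ k; in particular S(b) contains more than one point. -/
noncomputable section

open Filter Topology

/-- Near `t = 0`, an affine inequality `p + t * q ≤ r` persists along a line when it is strict at
`t = 0`, or when the slope vanishes. -/
lemma eventually_add_mul_le {p q r : ℝ} (hle : p ≤ r) (hq : p = r → q = 0) :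
    ∀ᶠ t : ℝ in 𝓝 0, p + t * q ≤ r := by
  rcases hle.lt_or_eq with hlt | heq
  · have hc : ContinuousAt (fun t : ℝ => p + t * q) 0 := by fun_prop
    have h0 : p + 0 * q < r := by simpa using hlt
    exact (hc.eventually_lt_const h0).mono fun t ht => ht.le
  · exact Eventually.of_forall fun t => by simp [hq heq, heq]

/-- The vectors annihilated by all differences of elements of `T`. -/
def orthDiff {n : ℕ} (T : Set (Fin n → ℝ)) : Submodule ℝ (Fin n → ℝ) :=
  ((Submodule.span ℝ {d : Fin n → ℝ | ∃ s ∈ T, ∃ s' ∈ T, d = s - s'}).map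
    (dotProductEquiv ℝ (Fin n)).toLinearMap).dualCoannihilator

lemma dotProduct_eq_of_mem_orthDiff {n : ℕ} {T : Set (Fin n → ℝ)} {d s s' : Fin n → ℝ}
    (hd : d ∈ orthDiff T) (hs : s ∈ T) (hs' : s' ∈ T) : s ⬝ᵥ d = s' ⬝ᵥ d := by
  have h := (Submodule.mem_dualCoannihilator _).1 hd (dotProductEquiv ℝ (Fin n) (s - s'))
    (Submodule.mem_map_of_mem (Submodule.subset_span ⟨s, hs, s', hs', rfl⟩))
  simpa [sub_dotProduct, sub_eq_zero] using h

lemma setDim_add_finrank_orthDiff {n : ℕ} (T : Set (Fin n → ℝ)) :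
    setDim T + Module.finrank ℝ (orthDiff T) = n := by
  have h := Subspace.finrank_add_finrank_dualCoannihilator_eq
    ((Submodule.span ℝ {d : Fin n → ℝ | ∃ s ∈ T, ∃ s' ∈ T, d = s - s'}).map
      (dotProductEquiv ℝ (Fin n)).toLinearMap)
  rw [LinearEquiv.finrank_map_eq, Module.finrank_fin_fun] at h
  exact h

lemma le_finrank_orthDiff_inf_ker {n m : ℕ} (T : Set (Fin n → ℝ))
    (A : Matrix (Fin m) (Fin n) ℝ) :
    n - setDim T - A.rank ≤
      Module.finrank ℝ (orthDiff T ⊓ LinearMap.ker A.mulVecLin : Submodule ℝ (Fin n → ℝ)) := by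
  have h1 := setDim_add_finrank_orthDiff T
  have h2 := A.mulVecLin.finrank_range_add_finrank_ker
  have h3 := Submodule.finrank_sup_add_finrank_inf_eq (orthDiff T) (LinearMap.ker A.mulVecLin)
  have h4 := Submodule.finrank_le (orthDiff T ⊔ LinearMap.ker A.mulVecLin)
  rw [Module.finrank_fin_fun] at h2 h4
  have h5 : A.rank = Module.finrank ℝ (LinearMap.range A.mulVecLin) := rfl
  omega

/-- A convex piecewise linear function is affine near `x` along directions orthogonal to all
differences of subgradients at `x`. -/
lemma IsCPWL.eventually_affine {n : ℕ} {f : (Fin n → ℝ) → EReal} (hf : IsCPWL f)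
    {x d : Fin n → ℝ} (hfx : f x < ⊤) (hd : d ∈ orthDiff (subdiff f x)) :
    ∃ r c : ℝ, ∀ᶠ t : ℝ in 𝓝 0, f (x + t • d) = ((r + t * c : ℝ) : EReal) := by
  obtain ⟨N, v, w, P, ⟨K, a, β, rfl⟩, hfin, htop⟩ := hf
  set P : Set (Fin n → ℝ) := {x | ∀ i, a i ⬝ᵥ x ≤ β i}
  have hxP : x ∈ P := by
    by_contra h
    exact hfx.ne (htop x h)
  replace hfin : ∀ y ∈ P, f y = ((Finset.univ.sup' Finset.univ_nonempty
      fun i => v i ⬝ᵥ y + w i : ℝ) : EReal) := hfin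
  obtain ⟨i₀, -, hi₀⟩ := Finset.exists_mem_eq_sup' Finset.univ_nonempty
    (fun i => v i ⬝ᵥ x + w i)
  have hmax (i) : v i ⬝ᵥ x + w i ≤ v i₀ ⬝ᵥ x + w i₀ := by
    rw [← hi₀]
    exact Finset.le_sup' (fun i => v i ⬝ᵥ x + w i) (Finset.mem_univ i)
  have hfx' : f x = ((v i₀ ⬝ᵥ x + w i₀ : ℝ) : EReal) := by rw [hfin x hxP, hi₀]
  have hsub (u : Fin n → ℝ) (i)
      (hi : v i ⬝ᵥ x + w i = v i₀ ⬝ᵥ x + w i₀) (hu : ∀ y ∈ P, u ⬝ᵥ y ≤ u ⬝ᵥ x) :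
      v i + u ∈ subdiff f x := by
    intro y
    change f x + (((v i + u) ⬝ᵥ (y - x) : ℝ) : EReal) ≤ f y
    by_cases hy : y ∈ P
    · rw [hfx', hfin y hy, ← EReal.coe_add, EReal.coe_le_coe_iff]
      refine le_trans ?_ (Finset.le_sup' (fun i => v i ⬝ᵥ y + w i) (Finset.mem_univ i))
      have := hu y hy
      simp only [add_dotProduct, dotProduct_sub]
      linarith
    · rw [htop y hy]
      exact le_top
  have hact (i) (hi : v i ⬝ᵥ x + w i = v i₀ ⬝ᵥ x + w i₀) : v i ∈ subdiff f x := by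
    simpa using hsub 0 i hi (by simp)
  have hv (i) (hi : v i ⬝ᵥ x + w i = v i₀ ⬝ᵥ x + w i₀) : v i ⬝ᵥ d = v i₀ ⬝ᵥ d :=
    dotProduct_eq_of_mem_orthDiff hd (hact i hi) (hact i₀ rfl)
  have ha (j) (hj : a j ⬝ᵥ x = β j) : a j ⬝ᵥ d = 0 := by
    have h := dotProduct_eq_of_mem_orthDiff hd
      (hsub (a j) i₀ rfl fun y hy => (hy j).trans hj.ge) (hact i₀ rfl)
    simpa [add_dotProduct] using h
  have evP : ∀ᶠ t : ℝ in 𝓝 0, ∀ j, a j ⬝ᵥ x + t * (a j ⬝ᵥ d) ≤ β j :=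
    eventually_all.2 fun j => eventually_add_mul_le (hxP j) (ha j)
  have evv : ∀ᶠ t : ℝ in 𝓝 0, ∀ i,
      (v i ⬝ᵥ x + w i) + t * (v i ⬝ᵥ d - v i₀ ⬝ᵥ d) ≤ v i₀ ⬝ᵥ x + w i₀ :=
    eventually_all.2 fun i => eventually_add_mul_le (hmax i) fun h => sub_eq_zero.2 (hv i h)
  refine ⟨v i₀ ⬝ᵥ x + w i₀, v i₀ ⬝ᵥ d, ?_⟩
  filter_upwards [evP, evv] with t htP htv
  have hmem : x + t • d ∈ P := fun j => by
    simpa [dotProduct_add, dotProduct_smul] using htP j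
  rw [hfin _ hmem, EReal.coe_eq_coe_iff]
  refine le_antisymm (Finset.sup'_le _ _ fun i _ => ?_) ?_
  · have := htv i
    simp only [dotProduct_add, dotProduct_smul, smul_eq_mul]
    linarith
  · refine le_trans (le_of_eq ?_)
      (Finset.le_sup' (fun i => v i ⬝ᵥ (x + t • d) + w i) (Finset.mem_univ i₀))
    simp only [dotProduct_add, dotProduct_smul, smul_eq_mul]
    ring

/-- From a solution `x` one can move a positive distance within the solution set along any
direction in `ker A` orthogonal to all differences of subgradients at `x`. -/
lemma exists_add_smul_mem_solSet {n m : ℕ} {D : (Fin m → ℝ) → (Fin m → ℝ) → ℝ}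
    {f : (Fin n → ℝ) → EReal} (hf : IsCPWL f) {A : Matrix (Fin m) (Fin n) ℝ}
    {b : Fin m → ℝ} {x d : Fin n → ℝ} (hx : x ∈ solSet D A f b) (hfx : f x < ⊤)
    (hd : d ∈ orthDiff (subdiff f x)) (hAd : A.mulVec d = 0) :
    ∃ t : ℝ, t ≠ 0 ∧ x + t • d ∈ solSet D A f b := by
  obtain ⟨r, c, h⟩ := hf.eventually_affine hfx hd
  obtain ⟨ε, hε, hball⟩ := Metric.eventually_nhds_iff.1 h
  have hA (t : ℝ) : A.mulVec (x + t • d) = A.mulVec x := by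
    simp [Matrix.mulVec_add, Matrix.mulVec_smul, hAd]
  have h0 : f x = (r : EReal) := by simpa using hball (y := 0) (by simpa using hε)
  have hp : f (x + (ε / 2) • d) = ((r + ε / 2 * c : ℝ) : EReal) :=
    hball (by rw [Real.dist_eq, sub_zero, abs_of_pos] <;> linarith)
  have hn : f (x + (-(ε / 2)) • d) = ((r + -(ε / 2) * c : ℝ) : EReal) :=
    hball (by rw [Real.dist_eq, sub_zero, abs_neg, abs_of_pos] <;> linarith)
  have hp' := hx (x + (ε / 2) • d)
  have hn' := hx (x + (-(ε / 2)) • d)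
  rw [hA, hp, h0] at hp'
  rw [hA, hn, h0] at hn'
  norm_cast at hp' hn'
  have hc : ε / 2 * c = 0 := by linarith
  refine ⟨ε / 2, by positivity, fun y => ?_⟩
  rw [hA, hp, hc, add_zero, ← h0]
  exact hx y

lemma setDim_eq_zero_of_subsingleton {n : ℕ} {T : Set (Fin n → ℝ)} (hT : T.Subsingleton) :
    setDim T = 0 := by
  have h : Submodule.span ℝ {d : Fin n → ℝ | ∃ s ∈ T, ∃ s' ∈ T, d = s - s'} = ⊥ := by
    rw [Submodule.span_eq_bot]
    rintro d ⟨s, hs, s', hs', rfl⟩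
    rw [hT hs hs', sub_self]
  rw [setDim, h, finrank_bot]

/-- Necessary condition for uniqueness: a solution whose subdifferential has codimension
exceeding the rank of `A` by `k > 0` forces a solution set of dimension at least `k`. -/
theorem nec_condition_uniqueness {n m : ℕ} (D : (Fin m → ℝ) → (Fin m → ℝ) → ℝ)
    (f : (Fin n → ℝ) → EReal) (hf : IsCPWL f) (A : Matrix (Fin m) (Fin n) ℝ)
    (b : Fin m → ℝ) (x : Fin n → ℝ) (hx : x ∈ solSet D A f b) (hfx : f x < ⊤)
    (k : ℕ) (hk : k = n - setDim (subdiff f x) - A.rank) (hkpos : 0 < k) :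
    k ≤ setDim (solSet D A f b) ∧ (solSet D A f b).Nontrivial := by
  have hdim : k ≤ setDim (solSet D A f b) := by
    rw [hk]
    refine (le_finrank_orthDiff_inf_ker (subdiff f x) A).trans (Submodule.finrank_mono ?_)
    rintro d ⟨hd, hAd⟩
    obtain ⟨t, ht, hmem⟩ := exists_add_smul_mem_solSet hf hx hfx hd (LinearMap.mem_ker.1 hAd)
    rw [← Submodule.smul_mem_iff _ ht]
    exact Submodule.subset_span ⟨x + t • d, hmem, x, hx, by simp⟩
  refine ⟨hdim, Set.not_subsingleton_iff.1 fun hS => ?_⟩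
  rw [setDim_eq_zero_of_subsingleton hS] at hdim
  omega

end
end
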